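/- Let s > 0, let B_s = {x ∈ ℝⁿ : |x| < 1/√s}, and let γ_s be the probability measure on ℝⁿ with density (1/Z_s)(1 − s|x|²)^{1/(2s)} 𝟙_{B_s}(x), where Z_s = ∫_{B_s}(1 − s|y|²)^{1/(2s)} dy. Then for all Borel probability measures ν₁, ν₂ with compact supports contained in B_s such that ν₂ is centered (∫ x dν₂(x) = 0), it holds T_{k_s}(ν₁,ν₂) ≤ H(ν₁|γ_s) + H(ν₂|γ_s), where k_s(x,y) = (1/s)·log( (1 − s x·y) / ((1 − s|x|²)^{1/2}(1 − s|y|²)^{1/2}) ) for x,y ∈ B_s. -/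

import Mathlib

open MeasureTheory Set Filter
open scoped RealInnerProductSpace ENNReal Topology

/-- The set of couplings of two measures: measures on the product whose marginals are the
given measures. -/
def Coupling {α : Type*} [MeasurableSpace α] (ν₁ ν₂ : Measure α) :
    Set (Measure (α × α)) :=
  {π | π.map Prod.fst = ν₁ ∧ π.map Prod.snd = ν₂}

/-- The optimal transport cost `T_c(ν₁,ν₂) = inf { ∫ c dπ : π coupling of ν₁ and ν₂}`. -/
noncomputable def transportCost {α : Type*} [MeasurableSpace α]
    (c : α → α → ℝ≥0∞) (ν₁ ν₂ : Measure α) : ℝ≥0∞ :=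
  ⨅ π ∈ Coupling ν₁ ν₂, ∫⁻ p, c p.1 p.2 ∂π

open Classical in
/-- Relative entropy `H(ν|μ) = ∫ log (dν/dμ) dν` if `ν ≪ μ` (and the integral exists),
`+∞` otherwise.  For probability measures the negative part of the integrand is always
integrable, so the `+∞` convention for the non-integrable case is the correct one. -/
noncomputable def relEnt {α : Type*} [MeasurableSpace α] (ν μ : Measure α) : ℝ≥0∞ :=
  if ν ≪ μ ∧ Integrable (llr ν μ) ν then ENNReal.ofReal (∫ x, llr ν μ x ∂ν) else ⊤


/-- The Barenblatt cost `k_s(x,y) = (1/s)·log((1 − s x·y)/((1 − s|x|²)^½ (1 − s|y|²)^½))`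
(it is nonnegative on `B_s × B_s`). -/
noncomputable def barenblattCost {n : ℕ} (s : ℝ)
    (x y : EuclideanSpace ℝ (Fin n)) : ℝ≥0∞ :=
  ENNReal.ofReal ((1 / s) * Real.log
    ((1 - s * ⟪x, y⟫) / (Real.sqrt (1 - s * ‖x‖ ^ 2) * Real.sqrt (1 - s * ‖y‖ ^ 2))))

/-- The Barenblatt probability measure `γ_s` with density `(1/Z_s)(1 − s|x|²)₊^{1/(2s)}`. -/
noncomputable def barenblattMeasure (n : ℕ) (s : ℝ) :
    Measure (EuclideanSpace ℝ (Fin n)) :=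
  volume.withDensity (fun x =>
    ENNReal.ofReal ((max (1 - s * ‖x‖ ^ 2) 0) ^ (1 / (2 * s))
      / ∫ y : EuclideanSpace ℝ (Fin n), (max (1 - s * ‖y‖ ^ 2) 0) ^ (1 / (2 * s))))

/-- One-dimensional Brunn-Minkowski inequality. -/
theorem volume_add_volume_le_of_add_mem {A B C : Set ℝ} (hA : MeasurableSet A)
    (hB : MeasurableSet B) (hAne : A.Nonempty) (hBne : B.Nonempty)
    (hC : ∀ a ∈ A, ∀ b ∈ B, a + b ∈ C) : volume A + volume B ≤ volume C := by
  have key : ∀ K ⊆ A, IsCompact K → ∀ L ⊆ B, IsCompact L → volume K + volume L ≤ volume C := by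
    have aux : ∀ K ⊆ A, IsCompact K → K.Nonempty → ∀ L ⊆ B, IsCompact L → L.Nonempty →
        volume K + volume L ≤ volume C := by
      intro K hKA hK hKne L hLB hL hLne
      obtain ⟨a, ha, hamax⟩ := hK.exists_isGreatest hKne
      obtain ⟨b, hb, hbmin⟩ := hL.exists_isLeast hLne
      have hsub : ((fun x => x + b) '' K) ∪ ((fun x => a + x) '' L) ⊆ C := by
        rintro _ (⟨x, hx, rfl⟩ | ⟨x, hx, rfl⟩)
        · exact hC _ (hKA hx) _ (hLB hb)
        · exact hC _ (hKA ha) _ (hLB hx)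
      have hdisj : AEDisjoint volume ((fun x => x + b) '' K) ((fun x => a + x) '' L) := by
        refine measure_mono_null (t := {a + b}) ?_ (by simp)
        rintro _ ⟨⟨x, hx, rfl⟩, ⟨y, hy, hxy⟩⟩
        have h1 := hamax hx
        have h2 := hbmin hy
        simp only at hxy
        simp only [mem_singleton_iff]
        linarith
      have hm : NullMeasurableSet ((fun x => a + x) '' L) volume :=
        (hL.image (by fun_prop)).measurableSet.nullMeasurableSet
      have := measure_union₀ hm hdisj
      calc volume K + volume L
          = volume ((fun x => x + b) '' K) + volume ((fun x => a + x) '' L) := by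
            simp
        _ = _ := this.symm
        _ ≤ volume C := measure_mono hsub
    intro K hKA hK L hLB hL
    obtain ⟨a, ha⟩ := hAne
    obtain ⟨b, hb⟩ := hBne
    refine le_trans (add_le_add (measure_mono (subset_insert a K))
      (measure_mono (subset_insert b L))) ?_
    exact aux _ (insert_subset ha hKA) (hK.insert a) (insert_nonempty _ _)
      _ (insert_subset hb hLB) (hL.insert b) (insert_nonempty _ _)
  rw [hA.measure_eq_iSup_isCompact, hB.measure_eq_iSup_isCompact]
  simp only [iSup_and']
  refine ENNReal.biSup_add_biSup_le' ⟨∅, empty_subset _, isCompact_empty⟩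
    ⟨∅, empty_subset _, isCompact_empty⟩ fun K hK L hL => key K hK.1 hK.2 L hL.1 hL.2

theorem lintegral_add_lintegral_le_of_normalized {f g h : ℝ → ℝ}
    (hf : Measurable f) (hg : Measurable g) (hh : Measurable h)
    (hf0 : ∀ x, 0 ≤ f x) (hg0 : ∀ x, 0 ≤ g x) (hh0 : ∀ x, 0 ≤ h x)
    (hf1 : ∀ x, f x ≤ 1) (hg1 : ∀ x, g x ≤ 1)
    (hfs : ∀ t < 1, ∃ x, t < f x) (hgs : ∀ t < 1, ∃ x, t < g x)
    (hfg : ∀ x y, f x * g y ≤ h ((x + y) / 2) ^ 2) :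
    (∫⁻ x, ENNReal.ofReal (f x)) + ∫⁻ x, ENNReal.ofReal (g x)
      ≤ 2 * ∫⁻ x, ENNReal.ofReal (h x) := by
  rw [lintegral_eq_lintegral_meas_lt _ (ae_of_all _ hf0) hf.aemeasurable,
    lintegral_eq_lintegral_meas_lt _ (ae_of_all _ hg0) hg.aemeasurable,
    lintegral_eq_lintegral_meas_lt _ (ae_of_all _ hh0) hh.aemeasurable,
    ← lintegral_const_mul' _ _ (by simp), ← lintegral_add_left' ?_]
  swap
  · apply Measurable.aemeasurable
    apply Antitone.measurable
    intro a b hab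
    exact measure_mono fun x hx => lt_of_le_of_lt hab hx
  refine setLIntegral_mono' measurableSet_Ioi fun t (ht : 0 < t) => ?_
  rcases lt_or_ge t 1 with h1 | h1
  · have h2 : (2 : ℝ≥0∞) * volume {a | t < h a} = volume {w | t < h (w / 2)} := by
      have := Real.volume_preimage_mul_left (a := (2 : ℝ)⁻¹) (by norm_num) {a | t < h a}
      rw [inv_inv, abs_of_pos two_pos, ENNReal.ofReal_ofNat] at this
      rw [← this]
      congr 1
      ext w
      simp [div_eq_inv_mul]
    rw [h2]
    refine volume_add_volume_le_of_add_mem (measurableSet_lt measurable_const hf)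
      (measurableSet_lt measurable_const hg) (hfs t h1) (hgs t h1) ?_
    intro a ha b hb
    simp only [mem_ofPred_eq] at *
    refine lt_of_pow_lt_pow_left₀ 2 (hh0 _) (lt_of_lt_of_le ?_ (hfg a b))
    nlinarith
  · have e1 : {a | t < f a} = ∅ := by
      ext a; simpa using (hf1 a).trans h1
    have e2 : {a | t < g a} = ∅ := by
      ext a; simpa using (hg1 a).trans h1
    simp [e1, e2]

/-- One-dimensional Prékopa-Leindler inequality with bounded majorant. -/
theorem lintegral_mul_lintegral_le_sq {f g h : ℝ → ℝ≥0∞}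
    (hf : Measurable f) (hg : Measurable g) (hh : Measurable h)
    {M : ℝ≥0∞} (hM : M ≠ ∞) (hhM : ∀ x, h x ≤ M)
    (hfg : ∀ x y, f x * g y ≤ h ((x + y) / 2) ^ 2) :
    (∫⁻ x, f x) * ∫⁻ x, g x ≤ (∫⁻ x, h x) ^ 2 := by
  by_cases hf0 : ∀ x, f x = 0
  · simp [hf0]
  by_cases hg0 : ∀ x, g x = 0
  · simp [hg0]
  push Not at hf0 hg0
  obtain ⟨x₀, hx₀⟩ := hf0
  obtain ⟨y₀, hy₀⟩ := hg0
  have hb : ∀ x y, f x * g y ≤ M ^ 2 := fun x y =>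
    (hfg x y).trans (pow_le_pow_left₀ zero_le (hhM _) 2)
  have hM2 : M ^ 2 ≠ ∞ := ENNReal.pow_ne_top hM
  set F := ⨆ x, f x with hF
  set G := ⨆ x, g x with hG
  have hF0 : F ≠ 0 := fun h0 => hx₀ (le_zero_iff.1 (h0 ▸ le_iSup f x₀))
  have hG0 : G ≠ 0 := fun h0 => hy₀ (le_zero_iff.1 (h0 ▸ le_iSup g y₀))
  have hFt : F ≠ ∞ := by
    refine ne_top_of_le_ne_top (ENNReal.div_ne_top hM2 hy₀) (iSup_le fun x => ?_)
    by_cases hgt : g y₀ = ∞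
    · have := hb x₀ y₀
      rw [hgt, ENNReal.mul_top hx₀] at this
      exact absurd (top_le_iff.1 this) hM2
    · exact (ENNReal.le_div_iff_mul_le (Or.inl hy₀) (Or.inl hgt)).2 (hb x y₀)
  have hGt : G ≠ ∞ := by
    refine ne_top_of_le_ne_top (ENNReal.div_ne_top hM2 hx₀) (iSup_le fun y => ?_)
    have hft : f x₀ ≠ ∞ := ne_top_of_le_ne_top hFt (le_iSup f x₀)
    refine (ENNReal.le_div_iff_mul_le (Or.inl hx₀) (Or.inl hft)).2 ?_
    rw [mul_comm]; exact hb x₀ y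
  have hfle : ∀ x, f x ≤ F := le_iSup f
  have hgle : ∀ x, g x ≤ G := le_iSup g
  have hFr : 0 < F.toReal := ENNReal.toReal_pos hF0 hFt
  have hGr : 0 < G.toReal := ENNReal.toReal_pos hG0 hGt
  have hft : ∀ x, f x ≠ ∞ := fun x => ne_top_of_le_ne_top hFt (hfle x)
  have hgt : ∀ x, g x ≠ ∞ := fun x => ne_top_of_le_ne_top hGt (hgle x)
  have hht : ∀ x, h x ≠ ∞ := fun x => ne_top_of_le_ne_top hM (hhM x)
  set S := Real.sqrt (F.toReal * G.toReal) with hS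
  have hSpos : 0 < S := Real.sqrt_pos.2 (mul_pos hFr hGr)
  have hS2 : S ^ 2 = F.toReal * G.toReal := Real.sq_sqrt (mul_pos hFr hGr).le
  have key := lintegral_add_lintegral_le_of_normalized (f := fun x => (f x).toReal / F.toReal)
    (g := fun x => (g x).toReal / G.toReal) (h := fun x => (h x).toReal / S)
    (hf.ennreal_toReal.div_const _) (hg.ennreal_toReal.div_const _) (hh.ennreal_toReal.div_const _)
    (fun x => by positivity) (fun x => by positivity) (fun x => by positivity)
    (fun x => div_le_one_of_le₀ (ENNReal.toReal_mono hFt (hfle x)) hFr.le)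
    (fun x => div_le_one_of_le₀ (ENNReal.toReal_mono hGt (hgle x)) hGr.le) ?_ ?_ ?_
  · have conv : ∀ (k : ℝ → ℝ≥0∞) (c : ℝ), 0 < c → (∀ x, k x ≠ ∞) →
        ∫⁻ x, ENNReal.ofReal ((k x).toReal / c) = (∫⁻ x, k x) * (ENNReal.ofReal c)⁻¹ := by
      intro k c hc hk
      rw [← lintegral_mul_const' _ _ (by simp [hc])]
      refine lintegral_congr fun x => ?_
      rw [ENNReal.ofReal_div_of_pos hc, ENNReal.ofReal_toReal (hk x), div_eq_mul_inv]
    rw [conv f _ hFr hft, conv g _ hGr hgt, conv h _ hSpos hht] at key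
    have amgm : ∀ a b c : ℝ≥0∞, a + b ≤ 2 * c → a * b ≤ c ^ 2 := by
      intro a b c habc
      by_cases hc : c = ∞
      · simp [hc]
      have hab : a + b ≠ ∞ := ne_top_of_le_ne_top (ENNReal.mul_ne_top (by simp) hc) habc
      obtain ⟨ha, hb⟩ := ENNReal.add_ne_top.1 hab
      lift a to NNReal using ha
      lift b to NNReal using hb
      lift c to NNReal using hc
      norm_cast at habc ⊢
      have h' : (a : ℝ) + b ≤ 2 * c := by exact_mod_cast habc
      have : (a : ℝ) * b ≤ c ^ 2 := by
        nlinarith [sq_nonneg ((a : ℝ) - b), a.2, b.2, c.2]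
      exact_mod_cast this
    have k2 := amgm _ _ _ key
    have hSS : (ENNReal.ofReal S) ^ 2 = ENNReal.ofReal F.toReal * ENNReal.ofReal G.toReal := by
      rw [← ENNReal.ofReal_pow hSpos.le, hS2, ENNReal.ofReal_mul hFr.le]
    rw [mul_pow, ← ENNReal.inv_pow, hSS,
      ENNReal.mul_inv (Or.inr (by simp)) (Or.inl (by simp)), mul_mul_mul_comm] at k2
    refine (ENNReal.mul_le_mul_iff_left ?_ ?_).1 k2
    · simp
    · simp [ENNReal.mul_eq_top, hFr, hGr]
  · intro t ht
    obtain ⟨x, hx⟩ : ∃ x, ENNReal.ofReal (t * F.toReal) < f x := by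
      rw [← lt_iSup_iff, ← hF]
      rw [← ENNReal.ofReal_toReal hFt]
      refine (ENNReal.ofReal_lt_ofReal_iff hFr).2 ?_
      rw [ENNReal.toReal_ofReal hFr.le]
      nlinarith
    refine ⟨x, (lt_div_iff₀ hFr).2 ?_⟩
    by_contra! hcon
    exact absurd hx (not_lt.2 ((ENNReal.le_ofReal_iff_toReal_le (hft x) (by
      exact ENNReal.toReal_nonneg.trans hcon)).2 hcon))
  · intro t ht
    obtain ⟨x, hx⟩ : ∃ x, ENNReal.ofReal (t * G.toReal) < g x := by
      rw [← lt_iSup_iff, ← hG]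
      rw [← ENNReal.ofReal_toReal hGt]
      refine (ENNReal.ofReal_lt_ofReal_iff hGr).2 ?_
      rw [ENNReal.toReal_ofReal hGr.le]
      nlinarith
    refine ⟨x, (lt_div_iff₀ hGr).2 ?_⟩
    by_contra! hcon
    exact absurd hx (not_lt.2 ((ENNReal.le_ofReal_iff_toReal_le (hgt x) (by
      exact ENNReal.toReal_nonneg.trans hcon)).2 hcon))
  · intro x y
    rw [div_mul_div_comm, div_pow, hS2]
    gcongr
    rw [← ENNReal.toReal_mul, ← ENNReal.toReal_pow]
    exact ENNReal.toReal_mono (ENNReal.pow_ne_top (hht _)) (hfg x y)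

/-- Multiplicative form of the one-dimensional Prékopa-Leindler inequality on the half-line. -/
theorem setLIntegral_Ioi_mul_le_sq {f g h : ℝ → ℝ≥0∞}
    (hf : Measurable f) (hg : Measurable g) (hh : Measurable h)
    {M : ℝ≥0∞} (hM : M ≠ ∞) (hhM : ∀ x > 0, ENNReal.ofReal x * h x ≤ M)
    (hfg : ∀ x > 0, ∀ y > 0, f x * g y ≤ h (Real.sqrt (x * y)) ^ 2) :
    (∫⁻ x in Ioi 0, f x) * ∫⁻ x in Ioi 0, g x ≤ (∫⁻ x in Ioi 0, h x) ^ 2 := by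
  have cov : ∀ k : ℝ → ℝ≥0∞,
      ∫⁻ x in Ioi 0, k x = ∫⁻ u, ENNReal.ofReal (Real.exp u) * k (Real.exp u) := by
    intro k
    have := lintegral_image_eq_lintegral_abs_deriv_mul (s := univ) MeasurableSet.univ
      (fun x _ => (Real.hasDerivAt_exp x).hasDerivWithinAt) Real.exp_injective.injOn k
    rw [image_univ, Real.range_exp, Measure.restrict_univ] at this
    simpa [abs_of_pos, Real.exp_pos] using this
  rw [cov, cov, cov]
  have hm : ∀ k : ℝ → ℝ≥0∞, Measurable k →
      Measurable fun u => ENNReal.ofReal (Real.exp u) * k (Real.exp u) := fun k hk =>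
    (Real.measurable_exp.ennreal_ofReal).mul (hk.comp Real.measurable_exp)
  refine lintegral_mul_lintegral_le_sq (hm f hf) (hm g hg) (hm h hh) hM
    (fun u => hhM _ (Real.exp_pos u)) fun u v => ?_
  have e1 : Real.exp ((u + v) / 2) = Real.sqrt (Real.exp u * Real.exp v) := by
    rw [← Real.exp_add, Real.exp_half]
  have e2 : ENNReal.ofReal (Real.exp u) * ENNReal.ofReal (Real.exp v)
      = ENNReal.ofReal (Real.exp ((u + v) / 2)) ^ 2 := by
    rw [← ENNReal.ofReal_mul (Real.exp_pos _).le, ← ENNReal.ofReal_pow (Real.exp_pos _).le,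
      ← Real.exp_add, ← Real.exp_nat_mul]
    congr 2
    push_cast
    ring
  rw [mul_mul_mul_comm, e2, mul_pow, e1]
  gcongr
  exact hfg _ (Real.exp_pos u) _ (Real.exp_pos v)

/-- The truncated power `t₊ ^ p` as an extended nonnegative real. -/
noncomputable def posPow (t p : ℝ) : ℝ≥0∞ := ENNReal.ofReal ((max t 0) ^ p)

theorem posPow_ne_top (t p : ℝ) : posPow t p ≠ ∞ := ENNReal.ofReal_ne_top

theorem posPow_half_sq (t p : ℝ) : posPow t (p / 2) ^ 2 = posPow t p := by
  have h : 0 ≤ max t 0 := le_max_right _ _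
  rw [posPow, posPow, ← ENNReal.ofReal_pow (by positivity), ← Real.rpow_mul_natCast h]
  congr 2
  push_cast
  ring

theorem posPow_mul {a : ℝ} (ha : 0 ≤ a) (b p : ℝ) :
    posPow (a * b) p = posPow a p * posPow b p := by
  have h : max (a * b) 0 = a * max b 0 := by
    rw [mul_max_of_nonneg _ _ ha, mul_zero]
  rw [posPow, posPow, posPow, ← ENNReal.ofReal_mul (by positivity), h, max_eq_left ha,
    Real.mul_rpow ha (le_max_right _ _)]

theorem posPow_of_nonpos {t p : ℝ} (ht : t ≤ 0) (hp : p ≠ 0) : posPow t p = 0 := by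
  rw [posPow, max_eq_right ht, Real.zero_rpow hp, ENNReal.ofReal_zero]

theorem posPow_add {t : ℝ} (ht : 0 < t) (p q : ℝ) :
    posPow t (p + q) = posPow t p * posPow t q := by
  rw [posPow, posPow, posPow, max_eq_left ht.le, Real.rpow_add ht,
    ENNReal.ofReal_mul (by positivity)]

theorem posPow_mono {t u p : ℝ} (htu : t ≤ u) (hp : 0 ≤ p) : posPow t p ≤ posPow u p :=
  ENNReal.ofReal_le_ofReal
    (Real.rpow_le_rpow (le_max_right _ _) (max_le_max htu le_rfl) hp)

theorem posPow_one (p : ℝ) : posPow 1 p = 1 := by simp [posPow]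

theorem measurable_posPow (p : ℝ) : Measurable fun t => posPow t p := by
  unfold posPow; fun_prop

/-- The half-line integral of `(1 - s r²)₊ ^ (p / 2)`. -/
noncomputable def halfMass (s p : ℝ) : ℝ≥0∞ :=
  ∫⁻ r in Ioi (0 : ℝ), posPow (1 - s * r ^ 2) (p / 2)

theorem halfMass_ne_top {s p : ℝ} (hs : 0 < s) (hp : 0 < p) : halfMass s p ≠ ∞ := by
  have hle : halfMass s p ≤ ∫⁻ r in Ioi (0 : ℝ), (Icc (0 : ℝ) (1 / Real.sqrt s)).indicator 1 r := by
    refine setLIntegral_mono' measurableSet_Ioi fun r (hr : 0 < r) => ?_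
    by_cases h : r ∈ Icc (0 : ℝ) (1 / Real.sqrt s)
    · rw [indicator_of_mem h, Pi.one_apply, ← posPow_one (p / 2)]
      exact posPow_mono (by nlinarith [mul_nonneg hs.le (sq_nonneg r)]) (by positivity)
    · rw [posPow_of_nonpos _ (by positivity)]
      · exact zero_le
      · have h1 : 1 / Real.sqrt s < r := by
          by_contra! hc
          exact h ⟨hr.le, hc⟩
        have hss := Real.sqrt_pos.2 hs
        rw [div_lt_iff₀ hss] at h1
        have h2 := Real.sq_sqrt hs.le
        nlinarith [mul_pos hr hss]
  refine ne_top_of_le_ne_top ?_ hle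
  refine ne_top_of_le_ne_top ?_ (setLIntegral_le_lintegral _ _)
  rw [lintegral_indicator_one measurableSet_Icc]
  simp

theorem halfMass_scaling {s p : ℝ} (hs : 0 < s) (hp : 0 < p) (A : ℝ) :
    ∫⁻ r in Ioi (0 : ℝ), posPow (A - s * r ^ 2) (p / 2)
      = posPow A ((p + 1) / 2) * halfMass s p := by
  rcases le_or_gt A 0 with hA | hA
  · rw [posPow_of_nonpos hA (by positivity), zero_mul]
    rw [← lintegral_zero (μ := volume.restrict (Ioi (0 : ℝ)))]
    refine lintegral_congr fun r => posPow_of_nonpos ?_ (by positivity)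
    nlinarith [mul_nonneg hs.le (sq_nonneg r)]
  · have hq : 0 < Real.sqrt A := Real.sqrt_pos.2 hA
    have := lintegral_image_eq_lintegral_abs_deriv_mul (s := Ioi (0 : ℝ)) measurableSet_Ioi
      (f := fun r => Real.sqrt A * r) (f' := fun _ => Real.sqrt A)
      (fun x _ => by simpa using ((hasDerivAt_id x).const_mul (Real.sqrt A)).hasDerivWithinAt)
      (fun x _ y _ h => mul_left_cancel₀ hq.ne' h) (fun r => posPow (A - s * r ^ 2) (p / 2))
    have him : (fun r => Real.sqrt A * r) '' Ioi (0 : ℝ) = Ioi 0 := by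
      ext r
      refine ⟨?_, fun hr => ⟨r / Real.sqrt A, div_pos hr hq, mul_div_cancel₀ r hq.ne'⟩⟩
      rintro ⟨x, hx, rfl⟩
      exact mul_pos hq hx
    rw [him, lintegral_const_mul' _ _ ENNReal.ofReal_ne_top] at this
    rw [this, halfMass]
    have e : ∀ r : ℝ, posPow (A - s * (Real.sqrt A * r) ^ 2) (p / 2)
        = posPow A (p / 2) * posPow (1 - s * r ^ 2) (p / 2) := by
      intro r
      rw [← posPow_mul hA.le, mul_pow, Real.sq_sqrt hA.le]
      congr 1; ring
    simp_rw [e]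
    rw [lintegral_const_mul' _ _ (posPow_ne_top _ _), ← mul_assoc]
    congr 1
    rw [add_div, posPow_add hA, mul_comm]
    congr 1
    rw [posPow, abs_of_pos hq, Real.sqrt_eq_rpow, max_eq_left hA.le]

theorem setLIntegral_Ioi_mul_le_posPow {s p : ℝ} (hs : 0 < s) (hp : 0 < p) (A : ℝ)
    {f g : ℝ → ℝ≥0∞} (hf : Measurable f) (hg : Measurable g)
    (hfg : ∀ a > 0, ∀ t > 0, f a * g t ≤ posPow (A - s * (a * t)) p) :
    (∫⁻ a in Ioi 0, f a) * ∫⁻ t in Ioi 0, g t ≤ posPow A (p + 1) * halfMass s p ^ 2 := by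
  rw [← posPow_half_sq A, ← mul_pow, ← halfMass_scaling hs hp]
  refine setLIntegral_Ioi_mul_le_sq hf hg
    ((measurable_posPow _).comp (by fun_prop : Measurable fun r : ℝ => A - s * r ^ 2))
    (M := ENNReal.ofReal (Real.sqrt (A / s)) * posPow A (p / 2))
    (ENNReal.mul_ne_top ENNReal.ofReal_ne_top (posPow_ne_top _ _)) ?_ ?_
  · intro x hx
    rcases le_or_gt (A - s * x ^ 2) 0 with h | h
    · rw [posPow_of_nonpos h (by positivity), mul_zero]
      exact zero_le
    · gcongr
      · apply Real.le_sqrt_of_sq_le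
        rw [le_div_iff₀ hs]
        linarith
      · exact posPow_mono (by nlinarith [mul_nonneg hs.le (sq_nonneg x)]) (by positivity)
  · intro x hx y hy
    rw [posPow_half_sq, Real.sq_sqrt (mul_pos hx hy).le]
    exact hfg x hx y hy

/-- The mass of the profile `(1 - s |x|²)₊ ^ (p / 2)` on `ℝⁿ`. -/
noncomputable def profileMass (n : ℕ) (s p : ℝ) : ℝ≥0∞ :=
  ∫⁻ x : Fin n → ℝ, posPow (1 - s * (x ⬝ᵥ x)) (p / 2)

theorem cons_dotProduct_cons {n : ℕ} (a t : ℝ) (x y : Fin n → ℝ) :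
    (Fin.cons a x : Fin (n + 1) → ℝ) ⬝ᵥ (Fin.cons t y : Fin (n + 1) → ℝ)
      = a * t + x ⬝ᵥ y := by
  simp [dotProduct, Fin.sum_univ_succ]

theorem measurable_finCons {n : ℕ} :
    Measurable fun q : ℝ × (Fin n → ℝ) => (Fin.cons q.1 q.2 : Fin (n + 1) → ℝ) := by
  refine measurable_pi_lambda _ fun i => ?_
  refine Fin.cases ?_ (fun j => ?_) i
  · simpa using measurable_fst
  · simp only [Fin.cons_succ]
    fun_prop

@[fun_prop]
theorem Measurable.finCons {n : ℕ} {α : Type*} [MeasurableSpace α] {u : α → ℝ}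
    {v : α → Fin n → ℝ} (hu : Measurable u) (hv : Measurable v) :
    Measurable fun q => (Fin.cons (u q) (v q) : Fin (n + 1) → ℝ) :=
  measurable_finCons.comp (hu.prodMk hv)

theorem lintegral_finSucc {n : ℕ} {f : (Fin (n + 1) → ℝ) → ℝ≥0∞} (hf : Measurable f) :
    ∫⁻ x, f x = ∫⁻ a : ℝ, ∫⁻ x : Fin n → ℝ, f (Fin.cons a x) := by
  have h := volume_preserving_piFinSuccAbove (fun _ : Fin (n + 1) => ℝ) 0
  rw [← h.symm.lintegral_comp_emb (MeasurableEquiv.measurableEmbedding _)]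
  rw [Measure.volume_eq_prod, lintegral_prod _ (by fun_prop)]
  refine lintegral_congr fun a => lintegral_congr fun x => ?_
  congr 1
  exact Fin.insertNth_zero' a x

theorem profileMass_succ {s p : ℝ} (hs : 0 < s) (hp : 0 < p) (n : ℕ) :
    profileMass (n + 1) s p = 2 * halfMass s p * profileMass n s (p + 1) := by
  have hm := measurable_posPow (p / 2)
  have hm' := measurable_posPow ((p + 1) / 2)
  rw [profileMass, lintegral_finSucc (by fun_prop), lintegral_lintegral_swap
    (by unfold Function.uncurry; fun_prop), profileMass,
    ← lintegral_const_mul _ (by fun_prop)]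
  refine lintegral_congr fun x => ?_
  simp only [cons_dotProduct_cons]
  have e : ∀ a : ℝ, 1 - s * (a * a + x ⬝ᵥ x) = (1 - s * (x ⬝ᵥ x)) - s * a ^ 2 :=
    fun a => by ring
  simp_rw [e]
  have h := halfMass_scaling hs hp (1 - s * (x ⬝ᵥ x))
  have hneg : ∫⁻ r in Iio (0 : ℝ), posPow (1 - s * (x ⬝ᵥ x) - s * r ^ 2) (p / 2)
      = ∫⁻ r in Ioi (0 : ℝ), posPow (1 - s * (x ⬝ᵥ x) - s * r ^ 2) (p / 2) := by
    have := (Measure.measurePreserving_neg (volume : Measure ℝ)).setLIntegral_comp_preimage_emb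
      (MeasurableEquiv.neg ℝ).measurableEmbedding
      (fun r => posPow (1 - s * (x ⬝ᵥ x) - s * r ^ 2) (p / 2)) (Ioi 0)
    simpa using this
  rw [← lintegral_add_compl _ (measurableSet_Ioi (a := (0 : ℝ))), compl_Ioi,
    setLIntegral_congr Iio_ae_eq_Iic.symm, hneg, h]
  ring

/-- Functional Santaló inequality for `posPow` kernels when the second function is centered. -/
def SantaloCentered (n : ℕ) (s : ℝ) : Prop :=
  ∀ p > 0, ∀ f g : (Fin n → ℝ) → ℝ≥0∞, Measurable f → Measurable g →
    (∀ x y, f x * g y ≤ posPow (1 - s * (x ⬝ᵥ y)) p) → ∫⁻ y, g y ≠ ∞ →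
    (∀ i, Integrable (fun y => y i) (volume.withDensity g)) →
    (∀ i, ∫ y, y i ∂(volume.withDensity g) = 0) →
    (∫⁻ x, f x) * ∫⁻ y, g y ≤ profileMass n s p ^ 2

theorem SantaloCentered.lintegral_halfSpace_le {n : ℕ} {s p : ℝ} (hs : 0 < s) (hp : 0 < p)
    (ih : SantaloCentered n s) {F G : ℝ → (Fin n → ℝ) → ℝ≥0∞}
    (hF : Measurable (Function.uncurry F)) (hG : Measurable (Function.uncurry G))
    (hFG : ∀ a > 0, ∀ t > 0, ∀ x y, F a x * G t y ≤ posPow (1 - s * (x ⬝ᵥ y) - s * (a * t)) p)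
    (hfin : ∫⁻ x, ∫⁻ a in Ioi 0, F a x ≠ ∞)
    (hInt : ∀ i, Integrable (fun x => x i)
      (volume.withDensity fun x => ∫⁻ a in Ioi 0, F a x))
    (hcent : ∀ i, ∫ x, x i ∂(volume.withDensity fun x => ∫⁻ a in Ioi 0, F a x) = 0) :
    (∫⁻ x, ∫⁻ a in Ioi 0, F a x) * (∫⁻ y, ∫⁻ t in Ioi 0, G t y)
      ≤ (halfMass s p * profileMass n s (p + 1)) ^ 2 := by
  have hF' : Measurable fun x => ∫⁻ a in Ioi 0, F a x :=
    Measurable.lintegral_prod_left' (f := fun q : ℝ × (Fin n → ℝ) => F q.1 q.2) hF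
  have hG' : Measurable fun x => ∫⁻ a in Ioi 0, G a x :=
    Measurable.lintegral_prod_left' (f := fun q : ℝ × (Fin n → ℝ) => G q.1 q.2) hG
  have hfib : ∀ x y, (∫⁻ a in Ioi 0, F a x) * (∫⁻ t in Ioi 0, G t y)
      ≤ posPow (1 - s * (x ⬝ᵥ y)) (p + 1) * halfMass s p ^ 2 := fun x y =>
    setLIntegral_Ioi_mul_le_posPow hs hp _ (hF.comp (by fun_prop : Measurable fun a => (a, x)))
      (hG.comp (by fun_prop : Measurable fun a => (a, y))) fun a ha t ht => hFG a ha t ht x y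
  have hct : halfMass s p ^ 2 ≠ ∞ := ENNReal.pow_ne_top (halfMass_ne_top hs hp)
  by_cases hc : halfMass s p ^ 2 = 0
  · simp only [hc, mul_zero, nonpos_iff_eq_zero, mul_eq_zero] at hfib
    by_cases h : ∀ x, ∫⁻ a in Ioi 0, F a x = 0
    · simp [h]
    · push Not at h
      obtain ⟨x, hx⟩ := h
      have : ∀ y, ∫⁻ t in Ioi 0, G t y = 0 := fun y => (hfib x y).resolve_left hx
      simp [this]
  · have := ih (p + 1) (by positivity) (fun y => (∫⁻ t in Ioi 0, G t y) / halfMass s p ^ 2)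
      (fun x => ∫⁻ a in Ioi 0, F a x) (hG'.div_const _) hF' (fun y x => ?_) hfin hInt hcent
    · simp_rw [div_eq_mul_inv] at this
      rw [lintegral_mul_const _ hG'] at this
      rw [mul_pow]
      calc (∫⁻ x, ∫⁻ a in Ioi 0, F a x) * (∫⁻ y, ∫⁻ t in Ioi 0, G t y)
          = halfMass s p ^ 2 * ((∫⁻ y, ∫⁻ t in Ioi 0, G t y) * (halfMass s p ^ 2)⁻¹ *
              ∫⁻ x, ∫⁻ a in Ioi 0, F a x) := by
            rw [mul_comm, ← mul_assoc, mul_comm (halfMass s p ^ 2), mul_assoc (lintegral _ _),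
              ENNReal.inv_mul_cancel hc hct, mul_one]
        _ ≤ _ := by gcongr
    · rw [dotProduct_comm, ← ENNReal.mul_div_right_comm]
      refine ENNReal.div_le_of_le_mul ?_
      rw [mul_comm]
      exact hfib x y

theorem exists_setLIntegral_Ioi_eq_half {m : ℝ → ℝ≥0∞} (hm : Measurable m)
    (hfin : ∫⁻ a, m a ≠ ∞) (h0 : ∫⁻ a, m a ≠ 0) :
    ∃ τ, ∫⁻ a in Ioi τ, m a = (∫⁻ a, m a) / 2 ∧ ∫⁻ a in Iio τ, m a = (∫⁻ a, m a) / 2 := by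
  have hae : ∀ᵐ a, m a < ∞ := ae_lt_top hm hfin
  have hInt : Integrable fun a => (m a).toReal := integrable_toReal_of_lintegral_ne_top
    hm.aemeasurable hfin
  set φ := fun a => (m a).toReal with hφ
  set M := ∫ a, φ a with hM
  have hMpos : 0 < M := by
    rw [hM, hφ, integral_toReal hm.aemeasurable hae]
    exact ENNReal.toReal_pos h0 hfin
  have hcont : Continuous fun t => ∫ a in (0 : ℝ)..t, φ a :=
    intervalIntegral.continuous_primitive (fun a b => hInt.intervalIntegrable) 0
  have hsplit : (∫ a in Iic (0 : ℝ), φ a) + ∫ a in Ioi (0 : ℝ), φ a = M :=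
    intervalIntegral.integral_Iic_add_Ioi hInt.integrableOn hInt.integrableOn
  have htop := intervalIntegral_tendsto_integral_Ioi (0 : ℝ) hInt.integrableOn tendsto_id
  have hbot := intervalIntegral_tendsto_integral_Iic (0 : ℝ) hInt.integrableOn tendsto_id
  set v := (∫ a in Ioi (0 : ℝ), φ a) - M / 2 with hv
  obtain ⟨t₁, ht₁⟩ := (htop.eventually (lt_mem_nhds (show v < _ by linarith))).exists
  obtain ⟨t₂, ht₂⟩ := (hbot.eventually (lt_mem_nhds
    (show -v < ∫ a in Iic (0 : ℝ), φ a by linarith))).exists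
  obtain ⟨τ, hτ⟩ := mem_range_of_exists_le_of_exists_ge hcont (c := v)
    ⟨t₂, by simp only [id] at ht₂; rw [intervalIntegral.integral_symm]; linarith⟩ ⟨t₁, ht₁.le⟩
  have e1 : ∫ a in Ioi τ, φ a = M / 2 := by
    have := intervalIntegral.integral_Ioi_sub_Ioi' (a := 0) (b := τ) (f := φ) (μ := volume)
      hInt.integrableOn hInt.integrableOn
    simp only at hτ
    linarith
  have e2 : ∫ a in Iic τ, φ a = M / 2 := by
    have := intervalIntegral.integral_Iic_add_Ioi (b := τ) (f := φ) (μ := volume)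
      hInt.integrableOn hInt.integrableOn
    linarith
  have conv : ∀ S : Set ℝ, ∫⁻ a in S, m a = ENNReal.ofReal (∫ a in S, φ a) := fun S => by
    rw [ofReal_integral_eq_lintegral_ofReal hInt.integrableOn (ae_of_all _ fun a => by positivity)]
    refine lintegral_congr_ae ?_
    filter_upwards [ae_restrict_of_ae hae] with a ha using (ENNReal.ofReal_toReal ha.ne).symm
  have hhalf : (∫⁻ a, m a) / 2 = ENNReal.ofReal (M / 2) := by
    have := conv univ
    rw [Measure.restrict_univ] at this
    rw [this, ENNReal.ofReal_div_of_pos two_pos, ENNReal.ofReal_ofNat]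
  refine ⟨τ, ?_, ?_⟩
  · rw [conv, e1, hhalf]
  · rw [setLIntegral_congr Iio_ae_eq_Iic, conv, e2, hhalf]

/-- The section of `f` along the direction `(1, w)` based at `z`, traversed with speed `ε`. -/
noncomputable def shearSection {n : ℕ} (f : (Fin (n + 1) → ℝ) → ℝ≥0∞) (z : Fin (n + 1) → ℝ)
    (w : Fin n → ℝ) (ε : ℝ) (a : ℝ) (x : Fin n → ℝ) : ℝ≥0∞ :=
  f (Fin.cons (z 0 + ε * a) (x + (Fin.tail z + (ε * a) • w)))

theorem measurable_shearSection {n : ℕ} {f : (Fin (n + 1) → ℝ) → ℝ≥0∞} (hf : Measurable f)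
    (z : Fin (n + 1) → ℝ) (w : Fin n → ℝ) (ε : ℝ) :
    Measurable (Function.uncurry (shearSection f z w ε)) := by
  unfold shearSection Function.uncurry
  exact hf.comp (Measurable.finCons (by fun_prop) (by fun_prop))

theorem lintegral_comp_add_sign_mul {ε : ℝ} (hε : ε = 1 ∨ ε = -1) (c : ℝ) (k : ℝ → ℝ≥0∞) :
    ∫⁻ a, k (c + ε * a) = ∫⁻ a, k a := by
  rcases hε with rfl | rfl
  · simp only [one_mul]
    exact lintegral_add_left_eq_self k c
  · simp only [neg_mul, one_mul, ← sub_eq_add_neg]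
    exact lintegral_sub_left_eq_self k c

/-- The linear coordinate complementary to the direction `(1, w)`. -/
def shearCoord {n : ℕ} (z : Fin (n + 1) → ℝ) (w : Fin n → ℝ) (x : Fin (n + 1) → ℝ) : Fin n → ℝ :=
  Fin.tail x - Fin.tail z - (x 0 - z 0) • w

theorem measurable_shearCoord {n : ℕ} (z : Fin (n + 1) → ℝ) (w : Fin n → ℝ) :
    Measurable (shearCoord z w) := by
  unfold shearCoord Fin.tail
  fun_prop

theorem map_restrict_shearCoord {n : ℕ} {f : (Fin (n + 1) → ℝ) → ℝ≥0∞} (hf : Measurable f)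
    (z : Fin (n + 1) → ℝ) (w : Fin n → ℝ) {ε : ℝ} (hε : ε = 1 ∨ ε = -1) :
    (((volume.withDensity f).restrict {x | 0 < ε * (x 0 - z 0)}).map (shearCoord z w))
      = volume.withDensity fun x => ∫⁻ a in Ioi 0, shearSection f z w ε a x := by
  have hε2 : ε * ε = 1 := by rcases hε with rfl | rfl <;> norm_num
  have hT := measurable_shearCoord z w
  have hS : MeasurableSet {x : Fin (n + 1) → ℝ | 0 < ε * (x 0 - z 0)} :=
    measurableSet_lt (by fun_prop) (by fun_prop)
  have hsec := measurable_shearSection hf z w ε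
  refine Measure.ext_of_lintegral _ fun φ hφ => ?_
  rw [lintegral_map hφ hT, restrict_withDensity hS]
  change ∫⁻ x, (φ ∘ shearCoord z w) x ∂_ = _
  rw [lintegral_withDensity_eq_lintegral_mul _ hf
    (hφ.comp hT), lintegral_withDensity_eq_lintegral_mul _
    (Measurable.lintegral_prod_left' (f := fun q : ℝ × (Fin n → ℝ) =>
      shearSection f z w ε q.1 q.2) hsec) hφ, ← lintegral_indicator hS,
    lintegral_finSucc ((hf.mul (hφ.comp hT)).indicator hS)]
  rw [← lintegral_comp_add_sign_mul hε (z 0)]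
  have e : ∀ a : ℝ, ∫⁻ x : Fin n → ℝ, {x : Fin (n + 1) → ℝ | 0 < ε * (x 0 - z 0)}.indicator
      (f * φ ∘ shearCoord z w) (Fin.cons (z 0 + ε * a) x)
      = ∫⁻ x : Fin n → ℝ, (Ioi (0 : ℝ)).indicator (fun a => shearSection f z w ε a x * φ x) a := by
    intro a
    rw [← lintegral_add_right_eq_self _ (Fin.tail z + (ε * a) • w)]
    refine lintegral_congr fun x => ?_
    by_cases ha : 0 < a
    · rw [indicator_of_mem (show a ∈ Ioi 0 from ha), indicator_of_mem]
      · simp only [Pi.mul_apply, Function.comp_apply, shearSection]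
        congr 2
        unfold shearCoord
        simp only [Fin.tail_cons, Fin.cons_zero, add_sub_cancel_left]
        abel
      · simp [← mul_assoc, hε2, ha]
    · rw [indicator_of_notMem (show a ∉ Ioi 0 from ha), indicator_of_notMem]
      simpa [← mul_assoc, hε2] using ha
  simp_rw [e]
  rw [lintegral_lintegral_swap]
  · refine lintegral_congr fun x => ?_
    rw [lintegral_indicator measurableSet_Ioi, Pi.mul_apply, lintegral_mul_const]
    exact hsec.comp (by fun_prop : Measurable fun a => (a, x))
  · have : Measurable ((Prod.fst ⁻¹' Ioi (0 : ℝ)).indicator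
        fun q : ℝ × (Fin n → ℝ) => shearSection f z w ε q.1 q.2 * φ q.2) :=
      (hsec.mul (hφ.comp measurable_snd)).indicator (measurable_fst measurableSet_Ioi)
    exact this.aemeasurable

theorem SantaloCentered.setLIntegral_halfSpace_mul_le {n : ℕ} {s p : ℝ} (hs : 0 < s) (hp : 0 < p)
    (ih : SantaloCentered n s) {f G : (Fin (n + 1) → ℝ) → ℝ≥0∞} (hf : Measurable f)
    (hG : Measurable G) (z : Fin (n + 1) → ℝ) (w : Fin n → ℝ) {ε : ℝ} (hε : ε = 1 ∨ ε = -1)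
    (hfG : ∀ x y, f (x + z) * G y ≤ posPow (1 - s * (x ⬝ᵥ y)) p)
    (hfin : ∫⁻ x, f x ≠ ∞) (hInt : ∀ i, Integrable (fun x => x i) (volume.withDensity f))
    (hcent : ∀ i, ∫ x in {x | 0 < ε * (x 0 - z 0)}, shearCoord z w x i ∂(volume.withDensity f) = 0) :
    (∫⁻ x in {x | 0 < ε * (x 0 - z 0)}, f x) *
      (∫⁻ y : Fin n → ℝ, ∫⁻ t in Ioi 0, G (Fin.cons (ε * t - w ⬝ᵥ y) y))
      ≤ (halfMass s p * profileMass n s (p + 1)) ^ 2 := by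
  have hε2 : ε * ε = 1 := by rcases hε with rfl | rfl <;> norm_num
  have hmap := map_restrict_shearCoord hf z w hε
  have hT := measurable_shearCoord z w
  have hS : MeasurableSet {x : Fin (n + 1) → ℝ | 0 < ε * (x 0 - z 0)} :=
    measurableSet_lt (by fun_prop) (by fun_prop)
  have hmass : ∫⁻ x, ∫⁻ a in Ioi 0, shearSection f z w ε a x
      = ∫⁻ x in {x | 0 < ε * (x 0 - z 0)}, f x := by
    have := congrArg (fun μ => μ univ) hmap
    rw [Measure.map_apply hT MeasurableSet.univ, preimage_univ, Measure.restrict_apply_univ,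
      withDensity_apply _ hS, withDensity_apply _ MeasurableSet.univ, Measure.restrict_univ] at this
    exact this.symm
  have : IsFiniteMeasure (volume.withDensity f) := isFiniteMeasure_withDensity hfin
  have hcoord : ∀ i, Integrable (fun x => shearCoord z w x i) (volume.withDensity f) := by
    intro i
    simp only [shearCoord, Pi.sub_apply, Fin.tail, Pi.smul_apply, smul_eq_mul]
    exact ((hInt _).sub (integrable_const _)).sub (((hInt _).sub (integrable_const _)).mul_const _)
  rw [← hmass]
  refine ih.lintegral_halfSpace_le hs hp (measurable_shearSection hf z w ε)
    (G := fun t y => G (Fin.cons (ε * t - w ⬝ᵥ y) y)) ?_ ?_ ?_ ?_ ?_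
  · unfold Function.uncurry
    exact hG.comp (Measurable.finCons (by fun_prop) (by fun_prop))
  · intro a _ t _ x y
    have h := hfG (Fin.cons (ε * a) (x + (ε * a) • w)) (Fin.cons (ε * t - w ⬝ᵥ y) y)
    convert h using 2
    · unfold shearSection
      congr 1
      ext i
      refine Fin.cases ?_ (fun j => ?_) i
      · simp [add_comm]
      · simp [Fin.tail]; ring
    · rw [cons_dotProduct_cons, add_dotProduct, smul_dotProduct, smul_eq_mul]
      linear_combination (s * a * t) * hε2
  · rw [hmass]
    exact ne_top_of_le_ne_top hfin (setLIntegral_le_lintegral _ _)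
  · intro i
    rw [← hmap]
    exact (integrable_map_measure (measurable_pi_apply i).aestronglyMeasurable hT.aemeasurable).2
      (hcoord i).integrableOn
  · intro i
    rw [← hmap, integral_map hT.aemeasurable (measurable_pi_apply i).aestronglyMeasurable]
    exact hcent i

theorem integral_pos_of_ae_pos {α : Type*} [MeasurableSpace α] {μ : Measure α} {φ : α → ℝ}
    (hφ : Integrable φ μ) (hμ : μ ≠ 0) (hpos : ∀ᵐ x ∂μ, 0 < φ x) : 0 < ∫ x, φ x ∂μ := by
  rw [integral_pos_iff_support_of_nonneg_ae (hpos.mono fun x hx => hx.le) hφ]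
  refine pos_iff_ne_zero.2 fun h0 => hμ ?_
  rw [← ae_eq_bot]
  have h1 : ∀ᵐ x ∂μ, x ∉ Function.support φ := measure_eq_zero_iff_ae_notMem.1 h0
  refine eventually_false_iff_eq_bot.1 ?_
  filter_upwards [h1, hpos] with x hx hx' using hx hx'.ne'

theorem integrable_const_sub_dotProduct {n : ℕ} {μ : Measure (Fin n → ℝ)} [IsFiniteMeasure μ]
    (hInt : ∀ i, Integrable (fun x => x i) μ) (c : ℝ) (u : Fin n → ℝ) :
    Integrable (fun x => c - x ⬝ᵥ u) μ := by
  unfold dotProduct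
  exact (integrable_const _).sub (integrable_finsetSum _ fun i _ => (hInt i).mul_const _)

theorem integral_const_sub_dotProduct {n : ℕ} {μ : Measure (Fin n → ℝ)} [IsFiniteMeasure μ]
    (hInt : ∀ i, Integrable (fun x => x i) μ) (c : ℝ) (u b : Fin n → ℝ)
    (hb : ∀ i, ∫ x, x i ∂μ = μ.real univ * b i) :
    ∫ x, (c - x ⬝ᵥ u) ∂μ = μ.real univ * (c - b ⬝ᵥ u) := by
  unfold dotProduct
  rw [integral_sub (integrable_const _) (integrable_finsetSum _ fun i _ => (hInt i).mul_const _),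
    integral_finsetSum _ fun i _ => (hInt i).mul_const _]
  simp_rw [integral_mul_const, hb]
  rw [integral_const, smul_eq_mul, mul_sub, Finset.mul_sum]
  simp_rw [mul_assoc]

theorem lintegral_shear_eq_add {n : ℕ} {G : (Fin (n + 1) → ℝ) → ℝ≥0∞} (hG : Measurable G)
    (w : Fin n → ℝ) :
    ∫⁻ y, G y = (∫⁻ y : Fin n → ℝ, ∫⁻ t in Ioi 0, G (Fin.cons (1 * t - w ⬝ᵥ y) y))
      + ∫⁻ y : Fin n → ℝ, ∫⁻ t in Ioi 0, G (Fin.cons (-1 * t - w ⬝ᵥ y) y) := by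
  rw [lintegral_finSucc hG, lintegral_lintegral_swap, ← lintegral_add_left]
  · refine lintegral_congr fun y => ?_
    have hm : Measurable fun t : ℝ => G (Fin.cons (t - w ⬝ᵥ y) y) :=
      hG.comp (Measurable.finCons (by fun_prop) (by fun_prop))
    have hneg : ∫⁻ t in Iio (0 : ℝ), G (Fin.cons (t - w ⬝ᵥ y) y)
        = ∫⁻ t in Ioi (0 : ℝ), G (Fin.cons (-1 * t - w ⬝ᵥ y) y) := by
      have := (Measure.measurePreserving_neg (volume : Measure ℝ)).setLIntegral_comp_preimage_emb
        (MeasurableEquiv.neg ℝ).measurableEmbedding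
        (fun t => G (Fin.cons (t - w ⬝ᵥ y) y)) (Iio 0)
      simpa using this.symm
    rw [← lintegral_sub_right_eq_self _ (w ⬝ᵥ y),
      ← lintegral_add_compl _ (measurableSet_Ioi (a := (0 : ℝ))), compl_Ioi,
      setLIntegral_congr Iio_ae_eq_Iic.symm, hneg]
    simp only [one_mul]
  · refine Measurable.lintegral_prod_right' (f := fun q : (Fin n → ℝ) × ℝ =>
      G (Fin.cons (1 * q.2 - w ⬝ᵥ q.1) q.1)) ?_
    exact hG.comp (Measurable.finCons (by fun_prop) (by fun_prop))
  · exact (hG.comp measurable_finCons).aemeasurable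

theorem SantaloCentered.exists_center {n : ℕ} {s : ℝ} (hs : 0 < s)
    (ih : SantaloCentered n s) {f : (Fin (n + 1) → ℝ) → ℝ≥0∞} (hf : Measurable f)
    (hf0 : ∫⁻ x, f x ≠ 0) (hfin : ∫⁻ x, f x ≠ ∞)
    (hInt : ∀ i, Integrable (fun x => x i) (volume.withDensity f)) :
    ∃ z : Fin (n + 1) → ℝ,
      (∀ y, (∀ x, f x ≠ 0 → 0 < 1 - s * (x ⬝ᵥ y)) → 0 < 1 - s * (z ⬝ᵥ y)) ∧
      ∀ p > 0, ∀ G : (Fin (n + 1) → ℝ) → ℝ≥0∞, Measurable G →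
        (∀ x y, f (x + z) * G y ≤ posPow (1 - s * (x ⬝ᵥ y)) p) →
        (∫⁻ x, f x) * ∫⁻ y, G y ≤ profileMass (n + 1) s p ^ 2 := by
  have hm : Measurable fun a : ℝ => ∫⁻ x : Fin n → ℝ, f (Fin.cons a x) :=
    Measurable.lintegral_prod_right' (f := fun q : ℝ × (Fin n → ℝ) => f (Fin.cons q.1 q.2))
      (hf.comp measurable_finCons)
  have hmf := lintegral_finSucc hf
  obtain ⟨τ, hτ1, hτ2⟩ := exists_setLIntegral_Ioi_eq_half hm (hmf ▸ hfin) (hmf ▸ hf0)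
  rw [← hmf] at hτ1 hτ2
  have hfm : IsFiniteMeasure (volume.withDensity f) := isFiniteMeasure_withDensity hfin
  have hS : ∀ ε : ℝ, MeasurableSet {x : Fin (n + 1) → ℝ | 0 < ε * (x 0 - τ)} := fun ε =>
    measurableSet_lt (by fun_prop) (by fun_prop)
  have hmassI : ∀ (ε : ℝ) (I : Set ℝ), MeasurableSet I → (∀ a, 0 < ε * (a - τ) ↔ a ∈ I) →
      ∫⁻ x in {x : Fin (n + 1) → ℝ | 0 < ε * (x 0 - τ)}, f x
        = ∫⁻ a in I, ∫⁻ x : Fin n → ℝ, f (Fin.cons a x) := by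
    intro ε I hI hεI
    rw [← lintegral_indicator (hS ε), lintegral_finSucc (hf.indicator (hS ε)),
      ← lintegral_indicator hI]
    refine lintegral_congr fun a => ?_
    by_cases ha : a ∈ I
    · rw [indicator_of_mem ha]
      refine lintegral_congr fun x => ?_
      rw [indicator_of_mem]
      simpa using (hεI a).2 ha
    · rw [indicator_of_notMem ha]
      rw [← lintegral_zero (μ := (volume : Measure (Fin n → ℝ)))]
      refine lintegral_congr fun x => ?_
      rw [indicator_of_notMem]
      simpa using fun h => ha ((hεI a).1 h)
  have hmass : ∀ ε : ℝ, ε = 1 ∨ ε = -1 →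
      ∫⁻ x in {x : Fin (n + 1) → ℝ | 0 < ε * (x 0 - τ)}, f x = (∫⁻ x, f x) / 2 := by
    rintro ε (rfl | rfl)
    · rw [hmassI 1 (Ioi τ) measurableSet_Ioi (fun a => by simp), hτ1]
    · rw [hmassI (-1) (Iio τ) measurableSet_Iio (fun a => by simp), hτ2]
  set μ := volume.withDensity f with hμ
  set H : ℝ → Set (Fin (n + 1) → ℝ) := fun ε => {x | 0 < ε * (x 0 - τ)} with hH
  set R : ℝ := ((∫⁻ x, f x) / 2).toReal with hR
  have hRpos : 0 < R := ENNReal.toReal_pos (by simpa using hf0) (ENNReal.div_ne_top hfin (by simp))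
  have hreal : ∀ ε : ℝ, ε = 1 ∨ ε = -1 → (μ.restrict (H ε)).real univ = R := by
    intro ε hε
    rw [measureReal_restrict_apply_univ, Measure.real, withDensity_apply _ (hS ε), hmass ε hε]
  have hne : ∀ ε : ℝ, ε = 1 ∨ ε = -1 → μ.restrict (H ε) ≠ 0 := by
    intro ε hε h0
    have := hreal ε hε
    rw [h0] at this
    simp at this
    exact hRpos.ne this
  have hIntε : ∀ (ε : ℝ) (i), Integrable (fun x => x i) (μ.restrict (H ε)) := fun ε i =>
    (hInt i).integrableOn
  set b : ℝ → Fin (n + 1) → ℝ := fun ε i => (∫ x in H ε, x i ∂μ) / R with hb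
  have hbint : ∀ ε : ℝ, ε = 1 ∨ ε = -1 → ∀ i,
      ∫ x in H ε, x i ∂μ = (μ.restrict (H ε)).real univ * b ε i := by
    intro ε hε i
    rw [hreal ε hε, hb, mul_div_cancel₀ _ hRpos.ne']
  have hlin : ∀ ε : ℝ, ε = 1 ∨ ε = -1 → ∀ (c : ℝ) (u : Fin (n + 1) → ℝ),
      ∫ x in H ε, (c - x ⬝ᵥ u) ∂μ = R * (c - b ε ⬝ᵥ u) := by
    intro ε hε c u
    rw [integral_const_sub_dotProduct (hIntε ε) c u (b ε) (hbint ε hε), hreal ε hε]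
  have hbpos : ∀ ε : ℝ, ε = 1 ∨ ε = -1 → ∀ (c : ℝ) (u : Fin (n + 1) → ℝ),
      (∀ x ∈ H ε, f x ≠ 0 → 0 < c - x ⬝ᵥ u) → 0 < c - b ε ⬝ᵥ u := by
    intro ε hε c u hpos
    have h := integral_pos_of_ae_pos (integrable_const_sub_dotProduct (hIntε ε) c u) (hne ε hε) ?_
    · rw [hlin ε hε] at h
      exact pos_of_mul_pos_right h hRpos.le
    · rw [ae_restrict_iff' (hS ε), hμ, ae_withDensity_iff hf]
      exact ae_of_all _ fun x hx hxH => hpos x hxH hx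
  have hsingle : ∀ (x : Fin (n + 1) → ℝ) (r : ℝ), x ⬝ᵥ Pi.single 0 r = x 0 * r := fun x r =>
    dotProduct_single _ _ _
  have hb1 : τ < b 1 0 := by
    have := hbpos 1 (Or.inl rfl) (-τ) (Pi.single 0 (-1)) fun x hx _ => by
      have hx' : 0 < 1 * (x 0 - τ) := hx
      rw [hsingle]; linarith
    rw [hsingle] at this; linarith
  have hb2 : b (-1) 0 < τ := by
    have := hbpos (-1) (Or.inr rfl) τ (Pi.single 0 1) fun x hx _ => by
      have hx' : 0 < -1 * (x 0 - τ) := hx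
      rw [hsingle]; linarith
    rw [hsingle] at this; linarith
  have hd : 0 < b 1 0 - b (-1) 0 := by linarith
  set α : ℝ := (τ - b (-1) 0) / (b 1 0 - b (-1) 0) with hα
  have hα0 : 0 < α := div_pos (by linarith) hd
  have hα1 : α < 1 := (div_lt_one hd).2 (by linarith)
  have hαd : α * (b 1 0 - b (-1) 0) = τ - b (-1) 0 := div_mul_cancel₀ _ hd.ne'
  set z : Fin (n + 1) → ℝ := α • b 1 + (1 - α) • b (-1) with hz
  set w : Fin n → ℝ := fun i => (b 1 i.succ - b (-1) i.succ) / (b 1 0 - b (-1) 0) with hw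
  have hwd : ∀ i, w i * (b 1 0 - b (-1) 0) = b 1 i.succ - b (-1) i.succ := fun i =>
    div_mul_cancel₀ _ hd.ne'
  have hz0 : z 0 = τ := by
    simp only [hz, Pi.add_apply, Pi.smul_apply, smul_eq_mul]
    linarith
  have hzi : ∀ i, z i = α * b 1 i + (1 - α) * b (-1) i := fun i => rfl
  refine ⟨z, fun y hy => ?_, fun p hp G hG hfG => ?_⟩
  · have h : ∀ ε : ℝ, ε = 1 ∨ ε = -1 → 0 < 1 - b ε ⬝ᵥ (s • y) := fun ε hε =>
      hbpos ε hε 1 (s • y) fun x _ hx => by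
        rw [dotProduct_smul, smul_eq_mul]; exact hy x hx
    have h1 := h 1 (Or.inl rfl)
    have h2 := h (-1) (Or.inr rfl)
    rw [dotProduct_smul, smul_eq_mul] at h1 h2
    rw [hz, add_dotProduct, smul_dotProduct, smul_dotProduct, smul_eq_mul, smul_eq_mul]
    nlinarith [mul_pos hα0 h1, mul_pos (sub_pos.2 hα1) h2]
  · have hcent : ∀ ε : ℝ, ε = 1 ∨ ε = -1 → ∀ i,
        ∫ x in {x | 0 < ε * (x 0 - z 0)}, shearCoord z w x i ∂μ = 0 := by
      intro ε hε i
      rw [hz0]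
      have e : ∀ x : Fin (n + 1) → ℝ, shearCoord z w x i
          = (z 0 * w i - z i.succ) - x ⬝ᵥ (Fin.cons (w i) (Pi.single i (-1)) :
              Fin (n + 1) → ℝ) := by
        intro x
        rw [← Fin.cons_self_tail x, cons_dotProduct_cons, dotProduct_single]
        simp only [shearCoord, Fin.tail_cons, Fin.cons_zero, Pi.sub_apply, Pi.smul_apply,
          smul_eq_mul]
        simp only [Fin.tail]
        ring
      simp_rw [e]
      rw [hlin ε hε, ← Fin.cons_self_tail (b ε), cons_dotProduct_cons, dotProduct_single]
      simp only [Fin.tail]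
      rw [hz0, hzi]
      refine mul_eq_zero_of_right _ ?_
      clear_value w α b
      rcases hε with rfl | rfl
      · linear_combination (α - 1) * hwd i - w i * hαd
      · linear_combination α * hwd i - w i * hαd
    have key : ∀ ε : ℝ, ε = 1 ∨ ε = -1 → (∫⁻ x, f x) / 2 *
        (∫⁻ y : Fin n → ℝ, ∫⁻ t in Ioi 0, G (Fin.cons (ε * t - w ⬝ᵥ y) y))
        ≤ (halfMass s p * profileMass n s (p + 1)) ^ 2 := by
      intro ε hε
      rw [← hmass ε hε, ← hz0]
      exact ih.setLIntegral_halfSpace_mul_le hs hp hf hG z w hε hfG hfin hInt (hcent ε hε)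
    have h2 : (2 : ℝ≥0∞) * ((∫⁻ x, f x) / 2) = ∫⁻ x, f x :=
      ENNReal.mul_div_cancel (by simp) (by simp)
    rw [lintegral_shear_eq_add hG w, profileMass_succ hs hp, ← h2, mul_assoc, mul_add]
    calc _ ≤ 2 * ((halfMass s p * profileMass n s (p + 1)) ^ 2
          + (halfMass s p * profileMass n s (p + 1)) ^ 2) := by
          gcongr
          · exact key 1 (Or.inl rfl)
          · exact key (-1) (Or.inr rfl)
      _ = _ := by ring

theorem lintegral_posPow_mul_comp_smul_le {n : ℕ} (s : ℝ) (z : Fin n → ℝ)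
    (h : (Fin n → ℝ) → ℝ≥0∞) :
    ∫⁻ y, posPow (1 - s * (z ⬝ᵥ y)) (-(n + 1)) * h ((1 - s * (z ⬝ᵥ y))⁻¹ • y) ≤ ∫⁻ y, h y := by
  obtain ⟨q, hqn⟩ : ∃ q : ℝ, q = -(n + 1) := ⟨_, rfl⟩
  have hq : q ≠ 0 := hqn ▸ neg_ne_zero.2 (by positivity)
  rw [← hqn]
  set U : Set (Fin n → ℝ) := {y | 0 < 1 - s * (z ⬝ᵥ y)} with hU
  have hUm : MeasurableSet U := measurableSet_lt (by fun_prop) (by fun_prop)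
  let ℓ : (Fin n → ℝ) →L[ℝ] ℝ := LinearMap.toContinuousLinearMap
    { toFun := fun y => z ⬝ᵥ y, map_add' := dotProduct_add z, map_smul' := by simp }
  have hℓ : ∀ y, ℓ y = z ⬝ᵥ y := fun _ => rfl
  let Φ : (Fin n → ℝ) → Fin n → ℝ := fun y => (1 - s * (z ⬝ᵥ y))⁻¹ • y
  let Φ' : (Fin n → ℝ) → (Fin n → ℝ) →L[ℝ] (Fin n → ℝ) := fun y =>
    (1 - s * (z ⬝ᵥ y))⁻¹ • (ContinuousLinearMap.id ℝ _
      + ℓ.smulRight (((1 - s * (z ⬝ᵥ y))⁻¹ * s) • y))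
  have hder : ∀ y ∈ U, HasFDerivWithinAt Φ (Φ' y) U y := by
    intro y hy
    have hy' : 1 - s * (z ⬝ᵥ y) ≠ 0 := ne_of_gt hy
    have h1 : HasFDerivAt (fun y => 1 - s * (z ⬝ᵥ y)) (-(s • ℓ)) y :=
      ((ℓ.hasFDerivAt).const_mul s).const_sub 1
    have h2 := ((hasDerivAt_inv hy').comp_hasFDerivAt y h1).smul (hasFDerivAt_id y)
    refine (h2.congr_fderiv ?_).hasFDerivWithinAt
    ext v i
    simp [Φ', hℓ]
    field_simp
  have hinj : InjOn Φ U := by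
    intro y hy y' hy' hyy
    have hy1 : (0 : ℝ) < 1 - s * (z ⬝ᵥ y) := hy
    have hy2 : (0 : ℝ) < 1 - s * (z ⬝ᵥ y') := hy'
    have e := congrArg (fun v => z ⬝ᵥ v) hyy
    simp only [Φ, dotProduct_smul, smul_eq_mul] at e
    have e' : z ⬝ᵥ y = z ⬝ᵥ y' := by
      field_simp at e
      linarith
    simp only [Φ, e'] at hyy
    exact smul_right_injective _ (inv_ne_zero hy2.ne') hyy
  have hdet : ∀ y ∈ U, ENNReal.ofReal |(Φ' y).det| = posPow (1 - s * (z ⬝ᵥ y)) q := by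
    intro y hy
    have hy1 : (0 : ℝ) < 1 - s * (z ⬝ᵥ y) := hy
    have e : ((Φ' y : (Fin n → ℝ) →L[ℝ] (Fin n → ℝ)) : (Fin n → ℝ) →ₗ[ℝ] (Fin n → ℝ))
        = (1 - s * (z ⬝ᵥ y))⁻¹ • LinearMap.transvection (ℓ : (Fin n → ℝ) →ₗ[ℝ] ℝ)
          (((1 - s * (z ⬝ᵥ y))⁻¹ * s) • y) := by
      ext v i
      simp [Φ', LinearMap.transvection]
      ring
    have e2 : (Φ' y).det = (1 - s * (z ⬝ᵥ y)) ^ q := by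
      rw [ContinuousLinearMap.det, e, LinearMap.det_smul, LinearMap.transvection.det]
      rw [ContinuousLinearMap.coe_coe, map_smul, hℓ, smul_eq_mul, Module.finrank_fin_fun, hqn,
        Real.rpow_neg hy1.le]
      have : (1 - s * (z ⬝ᵥ y)) ^ ((n : ℝ) + 1) = (1 - s * (z ⬝ᵥ y)) ^ (n + 1) := by
        rw [← Real.rpow_natCast]; push_cast; rfl
      rw [this, inv_pow]
      generalize z ⬝ᵥ y = u at *
      field_simp
      ring
    rw [e2, abs_of_pos (by positivity), posPow, max_eq_left hy1.le]
  calc ∫⁻ y, posPow (1 - s * (z ⬝ᵥ y)) q * h (Φ y)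
      = ∫⁻ y in U, posPow (1 - s * (z ⬝ᵥ y)) q * h (Φ y) := by
        rw [← lintegral_indicator hUm]
        refine lintegral_congr fun y => ?_
        by_cases hy : y ∈ U
        · rw [indicator_of_mem hy]
        · rw [indicator_of_notMem hy, posPow_of_nonpos (not_lt.1 hy) hq, zero_mul]
    _ = ∫⁻ y in U, ENNReal.ofReal |(Φ' y).det| * h (Φ y) :=
        setLIntegral_congr_fun hUm fun y hy => by rw [hdet y hy]
    _ = ∫⁻ y in Φ '' U, h y :=
        (lintegral_image_eq_lintegral_abs_det_fderiv_mul volume hUm hder hinj h).symm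
    _ ≤ _ := setLIntegral_le_lintegral _ _

/-- A weighted functional Santaló inequality: every `f` admits a point `z` such that the
inequality holds for all admissible `g` after weighting by a power of `1 - s z·y`. -/
def SantaloWeighted (n : ℕ) (s : ℝ) : Prop :=
  ∀ f : (Fin n → ℝ) → ℝ≥0∞, Measurable f → ∫⁻ x, f x ≠ 0 → ∫⁻ x, f x ≠ ∞ →
    (∀ i, Integrable (fun x => x i) (volume.withDensity f)) →
    ∃ z : Fin n → ℝ,
      (∀ y, (∀ x, f x ≠ 0 → 0 < 1 - s * (x ⬝ᵥ y)) → 0 < 1 - s * (z ⬝ᵥ y)) ∧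
      ∀ p > 0, ∀ g : (Fin n → ℝ) → ℝ≥0∞, Measurable g →
        (∀ x y, f x * g y ≤ posPow (1 - s * (x ⬝ᵥ y)) p) →
        (∫⁻ x, f x) * ∫⁻ y, posPow (1 - s * (z ⬝ᵥ y)) (-(p + n + 1)) * g y
          ≤ profileMass n s p ^ 2

theorem santaloWeighted_zero (s : ℝ) : SantaloWeighted 0 s := by
  intro f _ _ _ _
  refine ⟨0, by simp, fun p _ g _ hfg => ?_⟩
  have h := hfg 0 0
  rw [zero_dotProduct, mul_zero, sub_zero, posPow_one] at h
  have hu : ∀ u : (Fin 0 → ℝ) → ℝ≥0∞, ∫⁻ x, u x = u 0 := by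
    intro u
    rw [lintegral_unique, Measure.volume_pi_eq_dirac 0]
    simp
    exact congrArg u (Subsingleton.elim _ _)
  simp only [profileMass, hu, zero_dotProduct, mul_zero, sub_zero, posPow_one, one_mul, one_pow]
  exact h

theorem SantaloCentered.santaloWeighted_succ {n : ℕ} {s : ℝ} (hs : 0 < s)
    (ih : SantaloCentered n s) : SantaloWeighted (n + 1) s := by
  intro f hf hf0 hfin hInt
  obtain ⟨z, hz, hG⟩ := ih.exists_center hs hf hf0 hfin hInt
  refine ⟨z, hz, fun p hp g hg hfg => ?_⟩
  set V : Set (Fin (n + 1) → ℝ) := {y | 0 < 1 + s * (z ⬝ᵥ y)} with hV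
  have hVm : MeasurableSet V := measurableSet_lt (by fun_prop) (by fun_prop)
  have hpm := measurable_posPow p
  set G : (Fin (n + 1) → ℝ) → ℝ≥0∞ := V.indicator fun y =>
    posPow (1 + s * (z ⬝ᵥ y)) p * g ((1 + s * (z ⬝ᵥ y))⁻¹ • y) with hGdef
  have hGm : Measurable G := by
    refine Measurable.indicator (Measurable.mul (by fun_prop) (hg.comp ?_)) hVm
    fun_prop
  have hfG : ∀ x y, f (x + z) * G y ≤ posPow (1 - s * (x ⬝ᵥ y)) p := by
    intro x y
    by_cases hy : y ∈ V
    · have hy' : (0 : ℝ) < 1 + s * (z ⬝ᵥ y) := hy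
      rw [hGdef, indicator_of_mem hy, mul_left_comm]
      refine (mul_le_mul_right (hfg _ _) _).trans_eq ?_
      rw [← posPow_mul hy'.le, dotProduct_smul, add_dotProduct, smul_eq_mul]
      congr 1
      field_simp
      ring
    · rw [hGdef, indicator_of_notMem hy, mul_zero]
      exact zero_le
  refine le_trans (mul_le_mul_right ?_ _) (hG p hp G hGm hfG)
  refine le_trans (lintegral_mono fun y => ?_) (lintegral_posPow_mul_comp_smul_le s z G)
  rcases le_or_gt (1 - s * (z ⬝ᵥ y)) 0 with hy | hy
  · rw [posPow_of_nonpos hy (neg_ne_zero.2 (by positivity)), zero_mul]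
    exact zero_le
  · have e : 1 + s * (z ⬝ᵥ ((1 - s * (z ⬝ᵥ y))⁻¹ • y)) = (1 - s * (z ⬝ᵥ y))⁻¹ := by
      rw [dotProduct_smul, smul_eq_mul]
      field_simp
      ring
    have hyV : (1 - s * (z ⬝ᵥ y))⁻¹ • y ∈ V := by
      rw [hV, mem_ofPred_eq, e]
      positivity
    rw [hGdef, indicator_of_mem hyV, e, inv_inv, smul_smul, mul_inv_cancel₀ hy.ne', one_smul,
      ← mul_assoc]
    refine le_of_eq ?_
    congr 1
    have e3 : posPow (1 - s * (z ⬝ᵥ y))⁻¹ p = posPow (1 - s * (z ⬝ᵥ y)) (-p) := by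
      rw [posPow, posPow, max_eq_left hy.le, max_eq_left (by positivity), Real.rpow_neg hy.le,
        Real.inv_rpow hy.le]
    rw [e3, ← posPow_add hy]
    congr 1
    ring

theorem ofReal_integral_le_lintegral {α : Type*} [MeasurableSpace α] {μ : Measure α} {φ : α → ℝ}
    (hφ : Integrable φ μ) : ENNReal.ofReal (∫ x, φ x ∂μ) ≤ ∫⁻ x, ENNReal.ofReal (φ x) ∂μ := by
  rw [integral_eq_lintegral_pos_part_sub_lintegral_neg_part hφ]
  exact (ENNReal.ofReal_le_ofReal (sub_le_self _ ENNReal.toReal_nonneg)).trans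
    ENNReal.ofReal_toReal_le

theorem ofReal_exp_mul_le_posPow {u q : ℝ} (hu : u < 1) (hq : 0 ≤ q) :
    ENNReal.ofReal (Real.exp (q * u)) ≤ posPow (1 - u) (-q) := by
  have h : 0 < 1 - u := by linarith
  refine ENNReal.ofReal_le_ofReal ?_
  rw [max_eq_left h.le, Real.rpow_def_of_pos h, Real.exp_le_exp]
  nlinarith [Real.log_le_sub_one_of_pos h]

theorem SantaloWeighted.santaloCentered {n : ℕ} {s : ℝ} (h : SantaloWeighted n s) :
    SantaloCentered n s := by
  intro p hp f g hf hg hfg hgfin hInt hcent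
  set ν := volume.withDensity g with hν
  have hνfin : IsFiniteMeasure ν := isFiniteMeasure_withDensity hgfin
  set F : ℕ → (Fin n → ℝ) → ℝ≥0∞ := fun k =>
    (Metric.closedBall 0 k).indicator fun x => min (f x) k with hF
  have hFm : ∀ k, Measurable (F k) := fun k =>
    (hf.min measurable_const).indicator measurableSet_closedBall
  have hFle : ∀ k x, F k x ≤ f x := fun k x =>
    (indicator_le_self' (fun _ _ => zero_le) x).trans (min_le_left _ _)
  have hmono : Monotone F := by
    intro k l hkl x
    have hkl' : (k : ℝ) ≤ l := by exact_mod_cast hkl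
    refine (indicator_le_indicator_of_subset (Metric.closedBall_subset_closedBall hkl')
      (fun _ => zero_le) x).trans (indicator_le_indicator (min_le_min le_rfl ?_))
    exact_mod_cast hkl
  have hsup : ∀ x, ⨆ k, F k x = f x := by
    intro x
    refine le_antisymm (iSup_le fun k => hFle k x) ?_
    refine le_of_forall_lt fun c hc => ?_
    obtain ⟨k₁, hk₁⟩ := ENNReal.exists_nat_gt hc.ne_top
    obtain ⟨k₂, hk₂⟩ := exists_nat_ge ‖x‖
    refine lt_iSup_iff.2 ⟨max k₁ k₂, ?_⟩
    rw [hF]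
    dsimp only
    rw [indicator_of_mem]
    · exact lt_min hc (hk₁.trans_le (by exact_mod_cast le_max_left _ _))
    · rw [mem_closedBall_zero_iff]
      exact hk₂.trans (by exact_mod_cast le_max_right _ _)
  have hlim : ∫⁻ x, f x = ⨆ k, ∫⁻ x, F k x := by
    rw [← lintegral_iSup hFm hmono]
    simp_rw [hsup]
  rw [hlim, ENNReal.iSup_mul]
  refine iSup_le fun k => ?_
  rcases eq_or_ne (∫⁻ x, F k x) 0 with h0 | h0
  · rw [h0, zero_mul]; exact zero_le
  have hFbd : ∀ x, F k x ≤ (Metric.closedBall (0 : Fin n → ℝ) k).indicator (fun _ => (k : ℝ≥0∞)) x :=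
    fun x => indicator_le_indicator (min_le_right _ _)
  have hfin : ∫⁻ x, F k x ≠ ∞ := by
    refine ((lintegral_mono hFbd).trans_lt ?_).ne
    rw [lintegral_indicator_const measurableSet_closedBall]
    exact ENNReal.mul_lt_top (by simp) measure_closedBall_lt_top
  have hFfin : IsFiniteMeasure (volume.withDensity (F k)) := isFiniteMeasure_withDensity hfin
  obtain ⟨z, hz, hG⟩ := h (F k) (hFm k) h0 hfin fun i => by
    refine Integrable.of_bound (measurable_pi_apply i).aestronglyMeasurable k ?_
    rw [ae_withDensity_iff (hFm k)]
    refine ae_of_all _ fun x hx => ?_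
    have hxk : x ∈ Metric.closedBall (0 : Fin n → ℝ) k := by
      by_contra hxk
      exact hx (indicator_of_notMem hxk _)
    exact (norm_le_pi_norm x i).trans (mem_closedBall_zero_iff.1 hxk)
  refine le_trans (mul_le_mul_right ?_ _) (hG p hp g hg fun x y =>
    (mul_le_mul_left (hFle k x) _).trans (hfg x y))
  have hq : 0 ≤ p + n + 1 := by positivity
  set q := p + n + 1
  set v : Fin n → ℝ := (-(q * s)) • z with hv
  have hval : ∀ y, 1 - y ⬝ᵥ v = 1 + q * (s * (z ⬝ᵥ y)) := by
    intro y
    rw [hv, dotProduct_smul, dotProduct_comm, smul_eq_mul]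
    ring
  calc ∫⁻ y, g y = ENNReal.ofReal (∫ y, (1 - y ⬝ᵥ v) ∂ν) := by
        rw [integral_const_sub_dotProduct hInt 1 v 0 (by simpa using hcent), zero_dotProduct,
          sub_zero, mul_one, ofReal_measureReal, hν, withDensity_apply _ MeasurableSet.univ,
          Measure.restrict_univ]
    _ ≤ ∫⁻ y, ENNReal.ofReal (1 - y ⬝ᵥ v) ∂ν :=
        ofReal_integral_le_lintegral (integrable_const_sub_dotProduct hInt 1 v)
    _ = ∫⁻ y, g y * ENNReal.ofReal (1 - y ⬝ᵥ v) := by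
        rw [hν, lintegral_withDensity_eq_lintegral_mul _ hg (by fun_prop)]
        rfl
    _ ≤ _ := lintegral_mono fun y => by
        rcases eq_or_ne (g y) 0 with hy | hy
        · rw [hy, zero_mul, mul_zero]
        · rw [mul_comm, hval]
          refine mul_le_mul_left ((ENNReal.ofReal_le_ofReal
            ((add_comm _ _).trans_le (Real.add_one_le_exp _))).trans
              (ofReal_exp_mul_le_posPow ?_ hq)) _
          refine sub_pos.1 (hz y fun x hx => ?_)
          by_contra hneg
          have := (mul_le_mul_left (hFle k x) (g y)).trans (hfg x y)
          rw [posPow_of_nonpos (not_lt.1 hneg) hp.ne'] at this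
          exact mul_ne_zero hx hy (le_zero_iff.1 this)

theorem santaloWeighted {s : ℝ} (hs : 0 < s) (n : ℕ) : SantaloWeighted n s := by
  induction n with
  | zero => exact santaloWeighted_zero s
  | succ n ih => exact ih.santaloCentered.santaloWeighted_succ hs

/-- The cone of continuous functions dominating `φ ⊕ ψ + t (a - c)` for some `t ≥ 0` and some
continuous `φ`, `ψ` with `∫ φ dμ + ∫ ψ dν = 0`. -/
noncomputable def kantorovichCone {X Y : Type*} [TopologicalSpace X] [CompactSpace X]
    [MeasurableSpace X] [BorelSpace X] [TopologicalSpace Y] [CompactSpace Y] [MeasurableSpace Y]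
    [BorelSpace Y] (μ : Measure X) (ν : Measure Y) [IsFiniteMeasure μ] [IsFiniteMeasure ν]
    (c : C(X × Y, ℝ)) (a : ℝ) : PointedCone ℝ C(X × Y, ℝ) where
  carrier := {u | ∃ (φ : C(X, ℝ)) (ψ : C(Y, ℝ)) (t : ℝ), 0 ≤ t ∧
    ∫ x, φ x ∂μ + ∫ y, ψ y ∂ν = 0 ∧ ∀ q : X × Y, φ q.1 + ψ q.2 + t * (a - c q) ≤ u q}
  zero_mem' := ⟨0, 0, 0, le_rfl, by simp, by simp⟩
  add_mem' := by
    rintro u v ⟨φ, ψ, t, ht, h0, h⟩ ⟨φ', ψ', t', ht', h0', h'⟩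
    have hi : ∀ φ : C(X, ℝ), Integrable φ μ := fun φ =>
      φ.continuous.integrable_of_hasCompactSupport (HasCompactSupport.of_compactSpace _)
    have hi' : ∀ φ : C(Y, ℝ), Integrable φ ν := fun φ =>
      φ.continuous.integrable_of_hasCompactSupport (HasCompactSupport.of_compactSpace _)
    refine ⟨φ + φ', ψ + ψ', t + t', add_nonneg ht ht', ?_, fun q => ?_⟩
    · simp only [ContinuousMap.add_apply]
      rw [integral_add (hi φ) (hi φ'), integral_add (hi' ψ) (hi' ψ')]
      linarith
    · simp only [ContinuousMap.add_apply]
      linarith [h q, h' q]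
  smul_mem' := by
    rintro ⟨r, hr⟩ u ⟨φ, ψ, t, ht, h0, h⟩
    refine ⟨r • φ, r • ψ, r * t, mul_nonneg hr ht, ?_, fun q => ?_⟩
    · simp only [ContinuousMap.smul_apply, smul_eq_mul, integral_const_mul]
      rw [← mul_add, h0, mul_zero]
    · change r * φ q.1 + r * ψ q.2 + r * t * (a - c q) ≤ r * u q
      nlinarith [mul_le_mul_of_nonneg_left (h q) hr]

/-- The nontrivial half of Kantorovich duality on compact spaces. -/
theorem exists_coupling_integral_le {X Y : Type*} [MetricSpace X] [CompactSpace X]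
    [SecondCountableTopology X] [MeasurableSpace X] [BorelSpace X] [MetricSpace Y] [CompactSpace Y]
    [SecondCountableTopology Y] [MeasurableSpace Y] [BorelSpace Y] (μ : Measure X) (ν : Measure Y)
    [IsProbabilityMeasure μ] [IsProbabilityMeasure ν] (c : C(X × Y, ℝ)) (a : ℝ)
    (h : ∀ (φ : C(X, ℝ)) (ψ : C(Y, ℝ)), (∀ x y, φ x + ψ y ≤ c (x, y)) →
      ∫ x, φ x ∂μ + ∫ y, ψ y ∂ν ≤ a) :
    ∃ π : Measure (X × Y), π.map Prod.fst = μ ∧ π.map Prod.snd = ν ∧ ∫ q, c q ∂π ≤ a := by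
  have hi : ∀ φ : C(X, ℝ), Integrable φ μ := fun φ =>
    φ.continuous.integrable_of_hasCompactSupport (HasCompactSupport.of_compactSpace _)
  have hi' : ∀ φ : C(Y, ℝ), Integrable φ ν := fun φ =>
    φ.continuous.integrable_of_hasCompactSupport (HasCompactSupport.of_compactSpace _)
  have hX : Nonempty X := nonempty_of_isProbabilityMeasure μ
  have hY : Nonempty Y := nonempty_of_isProbabilityMeasure ν
  set S := kantorovichCone μ ν c a with hS
  have hmem : ∀ u : C(X × Y, ℝ), u ∈ S ↔ ∃ (φ : C(X, ℝ)) (ψ : C(Y, ℝ)) (t : ℝ), 0 ≤ t ∧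
    ∫ x, φ x ∂μ + ∫ y, ψ y ∂ν = 0 ∧ ∀ q : X × Y, φ q.1 + ψ q.2 + t * (a - c q) ≤ u q :=
    fun u => Iff.rfl
  have hconst : ∀ r : ℝ, r • (1 : C(X × Y, ℝ)) ∈ S → 0 ≤ r := by
    intro r hr
    obtain ⟨φ, ψ, t, ht, h0, hle⟩ := (hmem _).1 hr
    simp only [ContinuousMap.smul_apply, ContinuousMap.one_apply, smul_eq_mul, mul_one] at hle
    rcases ht.eq_or_lt with rfl | ht
    · have h1 : ∀ y, ∫ x, φ x ∂μ ≤ r - ψ y := fun y => by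
        have := integral_mono (hi φ) (integrable_const (r - ψ y)) fun x => by
          have := hle (x, y)
          simp only [zero_mul, add_zero] at this
          simpa using by linarith
        simpa using this
      have h2 := integral_mono (hi' ψ) (integrable_const (r - ∫ x, φ x ∂μ)) fun y => by
        simpa using by linarith [h1 y]
      simp only [integral_const, probReal_univ, one_smul] at h2
      linarith
    · have h1 := h (t⁻¹ • (φ - ContinuousMap.const X r) + ContinuousMap.const X a) (t⁻¹ • ψ)
        fun x y => by
          have := hle (x, y)
          simp only [ContinuousMap.add_apply, ContinuousMap.smul_apply, ContinuousMap.sub_apply,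
            ContinuousMap.const_apply, smul_eq_mul]
          refine le_of_mul_le_mul_left ?_ ht
          rw [mul_add, mul_add, ← mul_assoc, ← mul_assoc, mul_inv_cancel₀ ht.ne']
          linarith
      simp only [ContinuousMap.add_apply, ContinuousMap.smul_apply, ContinuousMap.sub_apply,
        ContinuousMap.const_apply, smul_eq_mul] at h1
      have hsub : Integrable (fun x => t⁻¹ * (φ x - r)) μ :=
        ((hi φ).sub (integrable_const r)).const_mul _
      rw [integral_add hsub (integrable_const a),
        integral_const_mul, integral_const_mul, integral_sub (hi φ) (integrable_const r)] at h1
      simp only [integral_const, probReal_univ, one_smul] at h1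
      have h2 : t⁻¹ * (-r) ≤ 0 := by
        have : ∫ y, ψ y ∂ν = -∫ x, φ x ∂μ := by linarith
        rw [this] at h1
        linarith
      have := nonpos_of_mul_nonpos_right h2 (inv_pos.2 ht)
      linarith
  have h1ne : (1 : C(X × Y, ℝ)) ≠ 0 := one_ne_zero
  obtain ⟨Λ, hΛ1, hΛS⟩ := riesz_extension S
    (LinearPMap.mkSpanSingleton (1 : C(X × Y, ℝ)) (1 : ℝ) h1ne) (by
      rintro ⟨u, hu⟩ huS
      obtain ⟨r, rfl⟩ := Submodule.mem_span_singleton.1 hu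
      rw [LinearPMap.mkSpanSingleton'_apply]
      simpa using hconst r huS) (by
      intro u
      refine ⟨⟨‖u‖ • 1, Submodule.mem_span_singleton.2 ⟨‖u‖, rfl⟩⟩, (hmem _).2
        ⟨0, 0, 0, le_rfl, by simp, fun q => ?_⟩⟩
      have := (abs_le.1 (u.norm_coe_le_norm q)).1
      simp only [ContinuousMap.add_apply, ContinuousMap.smul_apply, ContinuousMap.one_apply,
        ContinuousMap.zero_apply, smul_eq_mul, zero_mul, add_zero, mul_one]
      linarith)
  have hΛone : Λ 1 = 1 := by
    have := hΛ1 ⟨1, Submodule.mem_span_singleton_self _⟩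
    rwa [LinearPMap.mkSpanSingleton_apply] at this
  have hΛnonneg : ∀ u : C(X × Y, ℝ), (∀ q, 0 ≤ u q) → 0 ≤ Λ u := fun u hu =>
    hΛS u ((hmem u).2 ⟨0, 0, 0, le_rfl, by simp, fun q => by simpa using hu q⟩)
  have hmarg : ∀ (φ : C(X, ℝ)) (ψ : C(Y, ℝ)) (u : C(X × Y, ℝ)),
      (∀ q, u q = φ q.1 + ψ q.2) → Λ u = ∫ x, φ x ∂μ + ∫ y, ψ y ∂ν := by
    intro φ ψ u hu
    set m := ∫ x, φ x ∂μ + ∫ y, ψ y ∂ν with hm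
    have h1 := hΛS (u - m • 1) ((hmem _).2 ⟨φ - ContinuousMap.const X m, ψ, 0, le_rfl, by
      simp only [ContinuousMap.sub_apply, ContinuousMap.const_apply]
      rw [integral_sub (hi φ) (integrable_const m)]
      simp [hm], fun q => by simp [hu]; linarith⟩)
    have h2 := hΛS (m • 1 - u) ((hmem _).2 ⟨ContinuousMap.const X m - φ, -ψ, 0, le_rfl, by
      simp only [ContinuousMap.sub_apply, ContinuousMap.const_apply, ContinuousMap.neg_apply]
      rw [integral_sub (integrable_const m) (hi φ), integral_neg]
      simp [hm], fun q => by simp [hu]; linarith⟩)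
    rw [map_sub, map_smul, hΛone, smul_eq_mul, mul_one] at h1 h2
    linarith
  have hΛc : Λ c ≤ a := by
    have := hΛS (a • 1 - c) ((hmem _).2 ⟨0, 0, 1, zero_le_one, by simp, fun q => by simp⟩)
    rw [map_sub, map_smul, hΛone, smul_eq_mul, mul_one] at this
    linarith
  let L : CompactlySupportedContinuousMap (X × Y) ℝ →ₚ[ℝ] ℝ := PositiveLinearMap.mk₀
    { toFun := fun f => Λ f.toContinuousMap
      map_add' := fun f g => Λ.map_add _ _
      map_smul' := fun r f => Λ.map_smul _ _ } fun f hf => hΛnonneg _ fun q => hf q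
  set π := RealRMK.rieszMeasure L with hπ
  have hInt : ∀ u : C(X × Y, ℝ), ∫ q, u q ∂π = Λ u := fun u =>
    RealRMK.integral_rieszMeasure L (CompactlySupportedContinuousMap.continuousMapEquiv u)
  have hfin : IsFiniteMeasure π := inferInstance
  refine ⟨π, ?_, ?_, (hInt c).trans_le hΛc⟩
  · refine ext_of_forall_integral_eq_of_IsFiniteMeasure fun φ => ?_
    rw [integral_map measurable_fst.aemeasurable φ.continuous.aestronglyMeasurable]
    have := hmarg φ.toContinuousMap 0 (φ.toContinuousMap.comp ContinuousMap.fst) fun q => by simp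
    rw [← hInt] at this
    simpa using this
  · refine ext_of_forall_integral_eq_of_IsFiniteMeasure fun φ => ?_
    rw [integral_map measurable_snd.aemeasurable φ.continuous.aestronglyMeasurable]
    have := hmarg 0 φ.toContinuousMap (φ.toContinuousMap.comp ContinuousMap.snd) fun q => by simp
    rw [← hInt] at this
    simpa using this

/-- The Gibbs variational inequality. -/
theorem integral_le_integral_llr_add_log {α : Type*} [MeasurableSpace α] {ν γ : Measure α}
    [IsProbabilityMeasure ν] [SigmaFinite γ] (hac : ν ≪ γ) (hllr : Integrable (llr ν γ) ν)
    {K : Set α} (hK : MeasurableSet K) (hνK : ν Kᶜ = 0) {θ : α → ℝ} (hθm : Measurable θ)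
    (hθ : Integrable θ ν) {C : ℝ} (hC : 0 < C)
    (hle : ∫⁻ x in K, ENNReal.ofReal (Real.exp (θ x)) ∂γ ≤ ENNReal.ofReal C) :
    ∫ x, θ x ∂ν ≤ ∫ x, llr ν γ x ∂ν + Real.log C := by
  have hlm : Measurable (llr ν γ) := measurable_llr ν γ
  have h1 : ∫⁻ x, ENNReal.ofReal (Real.exp (θ x - llr ν γ x)) ∂ν ≤ ENNReal.ofReal C := by
    calc ∫⁻ x, ENNReal.ofReal (Real.exp (θ x - llr ν γ x)) ∂ν
        = ∫⁻ x in K, ENNReal.ofReal (Real.exp (θ x - llr ν γ x)) ∂ν := by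
          rw [Measure.restrict_eq_self_of_ae_mem]
          exact measure_eq_zero_iff_ae_notMem.1 hνK |>.mono fun x hx => not_not.1 hx
      _ = ∫⁻ x in K, ν.rnDeriv γ x * ENNReal.ofReal (Real.exp (θ x - llr ν γ x)) ∂γ :=
          (setLIntegral_rnDeriv_mul hac (by fun_prop) hK).symm
      _ ≤ ∫⁻ x in K, ENNReal.ofReal (Real.exp (θ x)) ∂γ := by
          refine lintegral_mono_ae (ae_restrict_of_ae ?_)
          filter_upwards [Measure.rnDeriv_lt_top ν γ] with x hx
          rcases eq_or_ne (ν.rnDeriv γ x) 0 with h0 | h0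
          · rw [h0, zero_mul]; exact zero_le
          · have hpos := ENNReal.toReal_pos h0 hx.ne
            rw [← ENNReal.ofReal_toReal hx.ne, ← ENNReal.ofReal_mul ENNReal.toReal_nonneg,
              Real.exp_sub, llr, Real.exp_log hpos, mul_div_cancel₀ _ hpos.ne']
      _ ≤ _ := hle
  have hInt : Integrable (fun x => θ x - llr ν γ x + (1 - Real.log C)) ν :=
    (hθ.sub hllr).add (integrable_const _)
  have h2 : ENNReal.ofReal (∫ x, (θ x - llr ν γ x + (1 - Real.log C)) ∂ν) ≤ 1 := by
    calc _ ≤ ∫⁻ x, ENNReal.ofReal (θ x - llr ν γ x + (1 - Real.log C)) ∂ν :=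
          ofReal_integral_le_lintegral hInt
      _ ≤ ∫⁻ x, ENNReal.ofReal (Real.exp (θ x - llr ν γ x)) * ENNReal.ofReal C⁻¹ ∂ν := by
          refine lintegral_mono fun x => ?_
          rw [← ENNReal.ofReal_mul (Real.exp_pos _).le, ← div_eq_mul_inv]
          refine ENNReal.ofReal_le_ofReal ?_
          have h := Real.add_one_le_exp (θ x - llr ν γ x - Real.log C)
          rw [Real.exp_sub _ (Real.log C), Real.exp_log hC] at h
          linarith
      _ = (∫⁻ x, ENNReal.ofReal (Real.exp (θ x - llr ν γ x)) ∂ν) * ENNReal.ofReal C⁻¹ :=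
          lintegral_mul_const _ (by fun_prop)
      _ ≤ ENNReal.ofReal C * ENNReal.ofReal C⁻¹ := mul_le_mul_left h1 _
      _ = 1 := by rw [← ENNReal.ofReal_mul hC.le, mul_inv_cancel₀ hC.ne', ENNReal.ofReal_one]
  have hsub : Integrable (fun x => θ x - llr ν γ x) ν := hθ.sub hllr
  rw [ENNReal.ofReal_le_one, integral_add hsub (integrable_const _), integral_sub hθ hllr,
    integral_const, probReal_univ, one_smul] at h2
  linarith

theorem lintegral_euclideanSpace {n : ℕ} (F : EuclideanSpace ℝ (Fin n) → ℝ≥0∞) :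
    ∫⁻ x, F x = ∫⁻ x : Fin n → ℝ, F (WithLp.toLp 2 x) :=
  ((EuclideanSpace.volume_preserving_symm_measurableEquiv_toLp (Fin n)).symm.lintegral_comp_emb
    (MeasurableEquiv.measurableEmbedding _) F).symm

theorem inner_toLp_eq_dotProduct {n : ℕ} (x y : Fin n → ℝ) :
    ⟪(WithLp.toLp 2 x : EuclideanSpace ℝ (Fin n)), WithLp.toLp 2 y⟫ = x ⬝ᵥ y := by
  rw [EuclideanSpace.inner_toLp_toLp, star_trivial, dotProduct_comm]

theorem exists_weight_euclideanSpace {n : ℕ} {s : ℝ} (hs : 0 < s) {R : ℝ}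
    {f : EuclideanSpace ℝ (Fin n) → ℝ≥0∞} (hf : Measurable f)
    (hfR : ∀ x, f x ≠ 0 → ‖x‖ ≤ R) (hf0 : ∫⁻ x, f x ≠ 0) (hfin : ∫⁻ x, f x ≠ ∞) :
    ∃ z : EuclideanSpace ℝ (Fin n),
      (∀ y, (∀ x, f x ≠ 0 → 0 < 1 - s * ⟪x, y⟫) → 0 < 1 - s * ⟪z, y⟫) ∧
      ∀ p > 0, ∀ g : EuclideanSpace ℝ (Fin n) → ℝ≥0∞, Measurable g →
        (∀ x y, f x * g y ≤ posPow (1 - s * ⟪x, y⟫) p) →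
        (∫⁻ x, f x) * ∫⁻ y, posPow (1 - s * ⟪z, y⟫) (-(p + n + 1)) * g y
          ≤ (∫⁻ x : EuclideanSpace ℝ (Fin n), posPow (1 - s * ‖x‖ ^ 2) (p / 2)) ^ 2 := by
  have hm : Measurable (WithLp.toLp 2 : (Fin n → ℝ) → EuclideanSpace ℝ (Fin n)) :=
    (MeasurableEquiv.toLp 2 (Fin n → ℝ)).measurable
  rw [lintegral_euclideanSpace] at hf0 hfin
  have hfm : Measurable fun x : Fin n → ℝ => f (WithLp.toLp 2 x) := hf.comp hm
  have hfinm : IsFiniteMeasure (volume.withDensity fun x : Fin n → ℝ => f (WithLp.toLp 2 x)) :=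
    isFiniteMeasure_withDensity hfin
  obtain ⟨z, hz, h⟩ := santaloWeighted hs n (fun x => f (WithLp.toLp 2 x)) hfm hf0 hfin fun i => by
    refine Integrable.of_bound (measurable_pi_apply i).aestronglyMeasurable R ?_
    rw [ae_withDensity_iff hfm]
    exact ae_of_all _ fun x hx => (PiLp.norm_apply_le (WithLp.toLp 2 x) i).trans (hfR _ hx)
  refine ⟨WithLp.toLp 2 z, fun y hy => ?_, fun p hp g hg hfg => ?_⟩
  · have := hz y.ofLp fun x hx => by
      have := hy (WithLp.toLp 2 x) hx
      rwa [← WithLp.toLp_ofLp 2 y, inner_toLp_eq_dotProduct] at this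
    rwa [← WithLp.toLp_ofLp 2 y, inner_toLp_eq_dotProduct]
  · have := h p hp (fun x => g (WithLp.toLp 2 x)) (hg.comp hm) fun x y => by
      rw [← inner_toLp_eq_dotProduct]
      exact hfg _ _
    simp_rw [lintegral_euclideanSpace, ← real_inner_self_eq_norm_sq, inner_toLp_eq_dotProduct]
    exact this

theorem exp_mul_profile_mul_le_posPow {E : Type*} [NormedAddCommGroup E] [InnerProductSpace ℝ E]
    {s : ℝ} {x y : E} {u v : ℝ} (hx : 0 < 1 - s * ‖x‖ ^ 2) (hy : 0 < 1 - s * ‖y‖ ^ 2)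
    (hxy : 0 < 1 - s * ⟪x, y⟫)
    (h : u + v ≤ 1 / s * Real.log ((1 - s * ⟪x, y⟫)
      / (Real.sqrt (1 - s * ‖x‖ ^ 2) * Real.sqrt (1 - s * ‖y‖ ^ 2)))) :
    (ENNReal.ofReal (Real.exp u) * posPow (1 - s * ‖x‖ ^ 2) (1 / s / 2))
        * (ENNReal.ofReal (Real.exp v) * posPow (1 - s * ‖y‖ ^ 2) (1 / s / 2))
      ≤ posPow (1 - s * ⟪x, y⟫) (1 / s) := by
  simp only [posPow]
  rw [max_eq_left hx.le, max_eq_left hy.le, max_eq_left hxy.le, Real.rpow_def_of_pos hx,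
    Real.rpow_def_of_pos hy, Real.rpow_def_of_pos hxy, ← ENNReal.ofReal_mul (Real.exp_pos _).le,
    ← ENNReal.ofReal_mul (Real.exp_pos _).le,
    ← ENNReal.ofReal_mul (mul_pos (Real.exp_pos _) (Real.exp_pos _)).le,
    ← Real.exp_add, ← Real.exp_add, ← Real.exp_add]
  refine ENNReal.ofReal_le_ofReal (Real.exp_le_exp.2 ?_)
  rw [Real.log_div hxy.ne' (mul_pos (Real.sqrt_pos.2 hx) (Real.sqrt_pos.2 hy)).ne',
    Real.log_mul (Real.sqrt_pos.2 hx).ne' (Real.sqrt_pos.2 hy).ne', Real.log_sqrt hx.le,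
    Real.log_sqrt hy.le] at h
  linarith

theorem one_sub_mul_norm_sq_pos {E : Type*} [NormedAddCommGroup E] {s R : ℝ} (hs : 0 < s)
    (hR : s * R ^ 2 < 1) (x : E) (hx : x ∈ Metric.closedBall (0 : E) R) :
    0 < 1 - s * ‖x‖ ^ 2 := by
  have hx' : ‖x‖ ≤ R := mem_closedBall_zero_iff.1 hx
  nlinarith [mul_le_mul_of_nonneg_left (pow_le_pow_left₀ (norm_nonneg x) hx' 2) hs.le]

theorem one_sub_mul_inner_pos {E : Type*} [NormedAddCommGroup E] [InnerProductSpace ℝ E]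
    {s : ℝ} (hs : 0 < s) {x y : E} (hx : 0 < 1 - s * ‖x‖ ^ 2) (hy : 0 < 1 - s * ‖y‖ ^ 2) :
    0 < 1 - s * ⟪x, y⟫ := by
  nlinarith [real_inner_le_norm x y, sq_nonneg (‖x‖ - ‖y‖)]

theorem barenblatt_normalization_pos {n : ℕ} {s : ℝ}
    {ν : Measure (EuclideanSpace ℝ (Fin n))} [IsProbabilityMeasure ν]
    (hac : ν ≪ barenblattMeasure n s) :
    0 < ∫ y : EuclideanSpace ℝ (Fin n), (max (1 - s * ‖y‖ ^ 2) 0) ^ (1 / (2 * s)) := by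
  refine lt_of_le_of_ne (integral_nonneg fun y => by positivity) fun h0 => ?_
  refine IsProbabilityMeasure.ne_zero ν (Measure.absolutelyContinuous_zero_iff.1 ?_)
  rw [barenblattMeasure, ← h0] at hac
  simpa using hac

theorem lintegral_profile_eq {n : ℕ} {s : ℝ}
    (hZ : 0 < ∫ y : EuclideanSpace ℝ (Fin n), (max (1 - s * ‖y‖ ^ 2) 0) ^ (1 / (2 * s))) :
    ∫⁻ x : EuclideanSpace ℝ (Fin n), posPow (1 - s * ‖x‖ ^ 2) (1 / s / 2)
      = ENNReal.ofReal
        (∫ y : EuclideanSpace ℝ (Fin n), (max (1 - s * ‖y‖ ^ 2) 0) ^ (1 / (2 * s))) := by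
  have hInt : Integrable fun y : EuclideanSpace ℝ (Fin n) =>
      (max (1 - s * ‖y‖ ^ 2) 0) ^ (1 / (2 * s)) := by
    by_contra h
    rw [integral_undef h] at hZ
    exact lt_irrefl _ hZ
  rw [ofReal_integral_eq_lintegral_ofReal hInt (ae_of_all _ fun y => by positivity)]
  simp only [posPow, div_div, mul_comm s 2]

theorem setLIntegral_barenblattMeasure {n : ℕ} {s : ℝ}
    (hZ : 0 < ∫ y : EuclideanSpace ℝ (Fin n), (max (1 - s * ‖y‖ ^ 2) 0) ^ (1 / (2 * s)))
    {K : Set (EuclideanSpace ℝ (Fin n))} (hK : MeasurableSet K)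
    {F : EuclideanSpace ℝ (Fin n) → ℝ≥0∞} (hF : Measurable F) :
    ∫⁻ x in K, F x ∂(barenblattMeasure n s)
      = (∫⁻ x, K.indicator (fun x => F x * posPow (1 - s * ‖x‖ ^ 2) (1 / s / 2)) x)
        / ENNReal.ofReal
          (∫ y : EuclideanSpace ℝ (Fin n), (max (1 - s * ‖y‖ ^ 2) 0) ^ (1 / (2 * s))) := by
  have hpm := measurable_posPow (1 / s / 2)
  have e : (1 / s / 2 : ℝ) = 1 / (2 * s) := by rw [div_div, mul_comm]
  rw [barenblattMeasure, setLIntegral_withDensity_eq_setLIntegral_mul _ (by fun_prop) hF hK,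
    lintegral_indicator hK, ENNReal.div_eq_inv_mul, ← lintegral_const_mul _ (by fun_prop)]
  refine lintegral_congr fun x => ?_
  rw [Pi.mul_apply, ENNReal.ofReal_div_of_pos hZ, ENNReal.div_eq_inv_mul, e, posPow]
  ring

theorem integral_add_integral_le_of_add_le_cost {n : ℕ} {s : ℝ} (hs : 0 < s)
    {ν₁ ν₂ : Measure (EuclideanSpace ℝ (Fin n))}
    [IsProbabilityMeasure ν₁] [IsProbabilityMeasure ν₂] {R : ℝ} (hR : s * R ^ 2 < 1)
    (hν₁ : ν₁ (Metric.closedBall 0 R)ᶜ = 0) (hν₂ : ν₂ (Metric.closedBall 0 R)ᶜ = 0)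
    (hcent : ∫ x, x ∂ν₂ = (0 : EuclideanSpace ℝ (Fin n)))
    (hac₁ : ν₁ ≪ barenblattMeasure n s) (hac₂ : ν₂ ≪ barenblattMeasure n s)
    (hllr₁ : Integrable (llr ν₁ (barenblattMeasure n s)) ν₁)
    (hllr₂ : Integrable (llr ν₂ (barenblattMeasure n s)) ν₂)
    (φ ψ : C(EuclideanSpace ℝ (Fin n), ℝ))
    (h : ∀ x ∈ Metric.closedBall (0 : EuclideanSpace ℝ (Fin n)) R,
      ∀ y ∈ Metric.closedBall (0 : EuclideanSpace ℝ (Fin n)) R,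
      φ x + ψ y ≤ 1 / s * Real.log ((1 - s * ⟪x, y⟫)
        / (Real.sqrt (1 - s * ‖x‖ ^ 2) * Real.sqrt (1 - s * ‖y‖ ^ 2)))) :
    ∫ x, φ x ∂ν₁ + ∫ y, ψ y ∂ν₂
      ≤ ∫ x, llr ν₁ (barenblattMeasure n s) x ∂ν₁
        + ∫ x, llr ν₂ (barenblattMeasure n s) x ∂ν₂ := by
  set K : Set (EuclideanSpace ℝ (Fin n)) := Metric.closedBall 0 R with hK
  have hKm : MeasurableSet K := measurableSet_closedBall
  have hKc : IsCompact K := isCompact_closedBall 0 R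
  have hKpos : ∀ x ∈ K, 0 < 1 - s * ‖x‖ ^ 2 := one_sub_mul_norm_sq_pos hs hR
  have hZ := barenblatt_normalization_pos hac₁
  have hprof := lintegral_profile_eq hZ
  have hγ := fun F => setLIntegral_barenblattMeasure hZ hKm (F := F)
  set Z : ℝ := ∫ y : EuclideanSpace ℝ (Fin n), (max (1 - s * ‖y‖ ^ 2) 0) ^ (1 / (2 * s))
  set γ := barenblattMeasure n s with hγdef
  have hpm := measurable_posPow (1 / s / 2)
  have hφm := φ.continuous.measurable
  have hψm := ψ.continuous.measurable
  have hp : 0 < 1 / s := by positivity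
  have hintK : ∀ (ν : Measure (EuclideanSpace ℝ (Fin n))) [IsProbabilityMeasure ν], ν Kᶜ = 0 →
      ∀ u : C(EuclideanSpace ℝ (Fin n), ℝ), Integrable u ν := by
    intro ν _ hν u
    have := u.continuous.continuousOn.integrableOn_compact (μ := ν) hKc
    rwa [IntegrableOn, Measure.restrict_eq_self_of_ae_mem] at this
    exact measure_eq_zero_iff_ae_notMem.1 hν |>.mono fun x hx => not_not.1 hx
  have hmass : ∀ u : C(EuclideanSpace ℝ (Fin n), ℝ), ∫⁻ x, K.indicator (fun x =>
      ENNReal.ofReal (Real.exp (u x)) * posPow (1 - s * ‖x‖ ^ 2) (1 / s / 2)) x ≠ ∞ := by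
    intro u
    obtain ⟨M, hM⟩ := hKc.bddAbove_image (u.continuous.continuousOn (s := K))
    refine ((lintegral_mono (g := fun x => ENNReal.ofReal (Real.exp M)
      * posPow (1 - s * ‖x‖ ^ 2) (1 / s / 2)) fun x => ?_).trans_lt ?_).ne
    · by_cases hx : x ∈ K
      · rw [indicator_of_mem hx]
        exact mul_le_mul_left (ENNReal.ofReal_le_ofReal
          (Real.exp_le_exp.2 (hM (mem_image_of_mem _ hx)))) _
      · rw [indicator_of_notMem hx]
        exact zero_le
    · rw [lintegral_const_mul _ (by fun_prop), hprof]
      exact ENNReal.mul_lt_top ENNReal.ofReal_lt_top ENNReal.ofReal_lt_top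
  have hnz : ∀ (u : EuclideanSpace ℝ (Fin n) → ℝ), ∀ x ∈ K,
      ENNReal.ofReal (Real.exp (u x)) * posPow (1 - s * ‖x‖ ^ 2) (1 / s / 2) ≠ 0 := by
    intro u x hx
    have := hKpos x hx
    refine mul_ne_zero (ENNReal.ofReal_pos.2 (Real.exp_pos _)).ne' (ENNReal.ofReal_pos.2 ?_).ne'
    rw [max_eq_left this.le]
    positivity
  set f : EuclideanSpace ℝ (Fin n) → ℝ≥0∞ := K.indicator fun x =>
    ENNReal.ofReal (Real.exp (φ x)) * posPow (1 - s * ‖x‖ ^ 2) (1 / s / 2) with hf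
  set g : EuclideanSpace ℝ (Fin n) → ℝ≥0∞ := K.indicator fun x =>
    ENNReal.ofReal (Real.exp (ψ x)) * posPow (1 - s * ‖x‖ ^ 2) (1 / s / 2) with hg
  have hfm : Measurable f := Measurable.indicator (by fun_prop) hKm
  have hgm : Measurable g := Measurable.indicator (by fun_prop) hKm
  have hfin : ∫⁻ x, f x ≠ ∞ := hmass φ
  have hf0 : ∫⁻ x, f x ≠ 0 := by
    intro h0
    have hKf : volume K = 0 := by
      refine measure_mono_null (fun x hx => ?_) (measure_eq_zero_iff_ae_notMem.2
        ((lintegral_eq_zero_iff hfm).1 h0 |>.mono fun x hx =>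
          (fun hne : x ∈ {x | f x ≠ 0} => hne hx)))
      change f x ≠ 0
      rw [hf, indicator_of_mem hx]
      exact hnz φ x hx
    have h1 : ν₁ K = 0 := hac₁ (withDensity_absolutelyContinuous _ _ hKf)
    have := measure_add_measure_compl (μ := ν₁) hKm
    rw [h1, hν₁, measure_univ] at this
    simp at this
  have hfK : ∀ x, f x ≠ 0 → x ∈ K := fun x hx => by
    by_contra hxK
    exact hx (indicator_of_notMem hxK _)
  obtain ⟨z, hz, hfg⟩ := exists_weight_euclideanSpace hs (R := R) hfm
    (fun x hx => mem_closedBall_zero_iff.1 (hfK x hx)) hf0 hfin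
  have hzK : ∀ y ∈ K, s * ⟪z, y⟫ < 1 := fun y hy => sub_pos.1 <| hz y fun x hx =>
    one_sub_mul_inner_pos hs (hKpos x (hfK x hx)) (hKpos y hy)
  have hAB := hfg (1 / s) hp g hgm fun x y => by
    by_cases hx : x ∈ K
    · by_cases hy : y ∈ K
      · rw [hf, hg, indicator_of_mem hx, indicator_of_mem hy]
        exact exp_mul_profile_mul_le_posPow (hKpos x hx) (hKpos y hy)
          (one_sub_mul_inner_pos hs (hKpos x hx) (hKpos y hy)) (h x hx y hy)
      · rw [hg, indicator_of_notMem hy, mul_zero]; exact zero_le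
    · rw [hf, indicator_of_notMem hx, zero_mul]; exact zero_le
  rw [hprof] at hAB
  set q : ℝ := 1 / s + n + 1 with hq
  have hq0 : 0 ≤ q := by positivity
  set A : ℝ := (∫⁻ x, f x).toReal with hA
  have hApos : 0 < A := ENNReal.toReal_pos hf0 hfin
  have hAeq : ∫⁻ x, f x = ENNReal.ofReal A := (ENNReal.ofReal_toReal hfin).symm
  let θ : C(EuclideanSpace ℝ (Fin n), ℝ) := ⟨fun y => ψ y + q * (s * ⟪z, y⟫), by fun_prop⟩
  have hγσ : SigmaFinite γ := by
    rw [hγdef, barenblattMeasure]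
    infer_instance
  have h1 := integral_le_integral_llr_add_log hac₁ hllr₁ hKm hν₁ hφm (hintK ν₁ hν₁ φ)
    (C := A / Z) (div_pos hApos hZ) (by
      rw [hγ _ (by fun_prop), ENNReal.ofReal_div_of_pos hZ, ← hAeq])
  have h2 := integral_le_integral_llr_add_log hac₂ hllr₂ hKm hν₂ θ.continuous.measurable
    (hintK ν₂ hν₂ θ) (C := (A / Z)⁻¹) (inv_pos.2 (div_pos hApos hZ)) (by
      have hθm := θ.continuous.measurable
      rw [hγ _ (by fun_prop), inv_div, ENNReal.ofReal_div_of_pos hApos]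
      have hle : ∫⁻ x, K.indicator (fun x =>
          ENNReal.ofReal (Real.exp (θ x)) * posPow (1 - s * ‖x‖ ^ 2) (1 / s / 2)) x
          ≤ ∫⁻ y, posPow (1 - s * ⟪z, y⟫) (-q) * g y := by
        refine lintegral_mono fun y => ?_
        by_cases hy : y ∈ K
        · rw [hg, indicator_of_mem hy, indicator_of_mem hy, ← mul_assoc]
          refine mul_le_mul_left ?_ _
          change ENNReal.ofReal (Real.exp (ψ y + q * (s * ⟪z, y⟫))) ≤ _
          rw [add_comm, Real.exp_add, ENNReal.ofReal_mul (Real.exp_pos _).le]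
          exact mul_le_mul_left (ofReal_exp_mul_le_posPow (hzK y hy) hq0) _
        · rw [indicator_of_notMem hy]; exact zero_le
      have hZ0 : ENNReal.ofReal Z ≠ 0 := (ENNReal.ofReal_pos.2 hZ).ne'
      have hA0 : ENNReal.ofReal A ≠ 0 := (ENNReal.ofReal_pos.2 hApos).ne'
      rw [hAeq] at hAB
      rw [ENNReal.le_div_iff_mul_le (.inl hA0) (.inl ENNReal.ofReal_ne_top), mul_comm,
        ← mul_div_assoc]
      refine ENNReal.div_le_of_le_mul ?_
      calc _ ≤ _ := mul_le_mul_right hle _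
        _ ≤ _ := hAB
        _ = _ := sq _)
  have h3 : ∫ y, θ y ∂ν₂ = ∫ y, ψ y ∂ν₂ := by
    have hid : Integrable (fun y : EuclideanSpace ℝ (Fin n) => y) ν₂ := by
      have := continuous_id.continuousOn.integrableOn_compact (μ := ν₂) hKc
      rwa [IntegrableOn, Measure.restrict_eq_self_of_ae_mem] at this
      exact measure_eq_zero_iff_ae_notMem.1 hν₂ |>.mono fun x hx => not_not.1 hx
    change ∫ y, (ψ y + q * (s * ⟪z, y⟫)) ∂ν₂ = _
    rw [integral_add (hintK ν₂ hν₂ ψ) (((hid.const_inner z).const_mul s).const_mul q),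
      integral_const_mul, integral_const_mul, integral_inner hid, hcent, inner_zero_right,
      mul_zero, mul_zero, add_zero]
  rw [Real.log_inv, h3] at h2
  linarith

theorem barenblatt_log_nonneg {E : Type*} [NormedAddCommGroup E] [InnerProductSpace ℝ E]
    {s : ℝ} (hs : 0 < s) {x y : E} (hx : 0 < 1 - s * ‖x‖ ^ 2) (hy : 0 < 1 - s * ‖y‖ ^ 2) :
    0 ≤ 1 / s * Real.log ((1 - s * ⟪x, y⟫)
      / (Real.sqrt (1 - s * ‖x‖ ^ 2) * Real.sqrt (1 - s * ‖y‖ ^ 2))) := by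
  refine mul_nonneg (by positivity) (Real.log_nonneg ?_)
  rw [one_le_div (mul_pos (Real.sqrt_pos.2 hx) (Real.sqrt_pos.2 hy))]
  nlinarith [real_inner_le_norm x y, sq_nonneg (‖x‖ - ‖y‖), Real.sq_sqrt hx.le, Real.sq_sqrt hy.le,
    sq_nonneg (Real.sqrt (1 - s * ‖x‖ ^ 2) - Real.sqrt (1 - s * ‖y‖ ^ 2)),
    mul_le_mul_of_nonneg_left (real_inner_le_norm x y) hs.le,
    mul_nonneg hs.le (sq_nonneg (‖x‖ - ‖y‖))]

theorem transportCost_le_of_integral_add_le {E : Type*} [MetricSpace E]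
    [SecondCountableTopology E] [MeasurableSpace E] [BorelSpace E]
    {ν₁ ν₂ : Measure E} [IsProbabilityMeasure ν₁] [IsProbabilityMeasure ν₂]
    {K : Set E} (hK : IsCompact K) (hν₁ : ν₁ Kᶜ = 0) (hν₂ : ν₂ Kᶜ = 0) {c : E → E → ℝ}
    (hc : ContinuousOn (fun p : E × E => c p.1 p.2) (K ×ˢ K))
    (hc0 : ∀ x ∈ K, ∀ y ∈ K, 0 ≤ c x y) {a : ℝ}
    (h : ∀ φ ψ : C(E, ℝ), (∀ x ∈ K, ∀ y ∈ K, φ x + ψ y ≤ c x y) →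
      ∫ x, φ x ∂ν₁ + ∫ y, ψ y ∂ν₂ ≤ a) :
    transportCost (fun x y => ENNReal.ofReal (c x y)) ν₁ ν₂ ≤ ENNReal.ofReal a := by
  have : CompactSpace K := isCompact_iff_compactSpace.1 hK
  have hKm : MeasurableSet K := hK.measurableSet
  have hres : ∀ ν : Measure E, ν Kᶜ = 0 → ν.restrict K = ν := fun ν hν =>
    Measure.restrict_eq_self_of_ae_mem
      ((measure_eq_zero_iff_ae_notMem.1 hν).mono fun _ hx => not_not.1 hx)
  have hmap : ∀ ν : Measure E, ν Kᶜ = 0 →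
      (ν.comap ((↑) : K → E)).map (↑) = ν := fun ν hν => by
    rw [map_comap_subtype_coe hKm, hres ν hν]
  have hprob : ∀ (ν : Measure E) [IsProbabilityMeasure ν], ν Kᶜ = 0 →
      IsProbabilityMeasure (ν.comap ((↑) : K → E)) := fun ν _ hν => by
    constructor
    have := congrArg (fun m : Measure E => m univ) (hmap ν hν)
    simpa [Measure.map_apply measurable_subtype_coe MeasurableSet.univ] using this
  have := hprob ν₁ hν₁
  have := hprob ν₂ hν₂
  let cK : C(K × K, ℝ) := ⟨fun p => c p.1 p.2, hc.comp_continuous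
    (f := fun p : K × K => ((p.1 : E), (p.2 : E))) (by fun_prop) fun p => ⟨p.1.2, p.2.2⟩⟩
  obtain ⟨π, hπ₁, hπ₂, hπ⟩ := exists_coupling_integral_le (ν₁.comap ((↑) : K → E))
    (ν₂.comap ((↑) : K → E)) cK a fun φ ψ hφψ => by
      obtain ⟨Φ, hΦ⟩ := ContinuousMap.exists_restrict_eq hK.isClosed φ
      obtain ⟨Ψ, hΨ⟩ := ContinuousMap.exists_restrict_eq hK.isClosed ψ
      have hΦ' : ∀ x : K, φ x = Φ x := fun x => by rw [← hΦ]; rfl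
      have hΨ' : ∀ x : K, ψ x = Ψ x := fun x => by rw [← hΨ]; rfl
      simp only [hΦ', hΨ'] at hφψ ⊢
      rw [integral_subtype_comap hKm Φ, integral_subtype_comap hKm Ψ, hres ν₁ hν₁, hres ν₂ hν₂]
      exact h Φ Ψ fun x hx y hy => hφψ ⟨x, hx⟩ ⟨y, hy⟩
  have hπf : IsFiniteMeasure π := by
    constructor
    rw [← preimage_univ (f := Prod.fst), ← Measure.map_apply measurable_fst MeasurableSet.univ,
      hπ₁]
    exact measure_lt_top _ _
  let ι : K × K → E × E := Prod.map (↑) (↑)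
  have hι : Measurable ι := measurable_subtype_coe.prodMap measurable_subtype_coe
  have hιe : MeasurableEmbedding ι :=
    (MeasurableEmbedding.subtype_coe hKm).prodMap (MeasurableEmbedding.subtype_coe hKm)
  calc transportCost (fun x y => ENNReal.ofReal (c x y)) ν₁ ν₂
      ≤ ∫⁻ p, ENNReal.ofReal (c p.1 p.2) ∂(π.map ι) := by
        refine iInf₂_le (π.map ι) ⟨?_, ?_⟩
        · rw [Measure.map_map measurable_fst hι, ← hmap ν₁ hν₁, ← hπ₁,
            Measure.map_map measurable_subtype_coe measurable_fst]
          rfl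
        · rw [Measure.map_map measurable_snd hι, ← hmap ν₂ hν₂, ← hπ₂,
            Measure.map_map measurable_subtype_coe measurable_snd]
          rfl
    _ = ∫⁻ p, ENNReal.ofReal (cK p) ∂π := hιe.lintegral_map _
    _ = ENNReal.ofReal (∫ p, cK p ∂π) := by
        refine (ofReal_integral_eq_lintegral_ofReal ?_ (ae_of_all _ fun p =>
          hc0 _ p.1.2 _ p.2.2)).symm
        exact cK.continuous.integrable_of_hasCompactSupport
          (HasCompactSupport.of_compactSpace cK)
    _ ≤ ENNReal.ofReal a := ENNReal.ofReal_le_ofReal hπ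

/-- Transport-entropy inequality for Barenblatt profiles: for `s > 0` and all probability
measures `ν₁, ν₂` with compact supports contained in the open ball `B_s` of radius `1/√s`,
with `ν₂` centered, it holds `T_{k_s}(ν₁,ν₂) ≤ H(ν₁|γ_s) + H(ν₂|γ_s)`. -/
theorem transport_entropy_barenblatt (n : ℕ) (s : ℝ) (hs : 0 < s)
    (ν₁ ν₂ : Measure (EuclideanSpace ℝ (Fin n)))
    [IsProbabilityMeasure ν₁] [IsProbabilityMeasure ν₂]
    (K₁ K₂ : Set (EuclideanSpace ℝ (Fin n)))
    (hK₁comp : IsCompact K₁) (hK₂comp : IsCompact K₂)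
    (hK₁sub : K₁ ⊆ Metric.ball 0 (1 / Real.sqrt s))
    (hK₂sub : K₂ ⊆ Metric.ball 0 (1 / Real.sqrt s))
    (hν₁supp : ν₁ K₁ᶜ = 0) (hν₂supp : ν₂ K₂ᶜ = 0)
    (hν₂cent : ∫ x, x ∂ν₂ = (0 : EuclideanSpace ℝ (Fin n))) :
    transportCost (barenblattCost s) ν₁ ν₂
      ≤ relEnt ν₁ (barenblattMeasure n s) + relEnt ν₂ (barenblattMeasure n s) := by
  unfold relEnt
  split_ifs with h₁ h₂
  · obtain ⟨R, hR, hKR⟩ : ∃ R : ℝ, s * R ^ 2 < 1 ∧ K₁ ∪ K₂ ⊆ Metric.closedBall 0 R := by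
      rcases (K₁ ∪ K₂).eq_empty_or_nonempty with hemp | hne
      · exact ⟨0, by simp, hemp ▸ empty_subset _⟩
      · obtain ⟨x, hx, hmax⟩ := (hK₁comp.union hK₂comp).exists_isMaxOn hne
          continuous_norm.continuousOn
        refine ⟨‖x‖, ?_, fun y hy => mem_closedBall_zero_iff.2 (hmax hy)⟩
        have hx' : ‖x‖ < 1 / Real.sqrt s := mem_ball_zero_iff.1 (union_subset hK₁sub hK₂sub hx)
        rw [lt_div_iff₀ (Real.sqrt_pos.2 hs)] at hx'
        calc s * ‖x‖ ^ 2 = (‖x‖ * Real.sqrt s) ^ 2 := by rw [mul_pow, Real.sq_sqrt hs.le, mul_comm]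
          _ < 1 := pow_lt_one₀ (by positivity) hx' two_ne_zero
    have hν₁ := measure_mono_null
      (compl_subset_compl.2 (subset_union_left.trans hKR)) hν₁supp
    have hν₂ := measure_mono_null
      (compl_subset_compl.2 (subset_union_right.trans hKR)) hν₂supp
    have hpos : ∀ x ∈ Metric.closedBall (0 : EuclideanSpace ℝ (Fin n)) R,
        0 < 1 - s * ‖x‖ ^ 2 := one_sub_mul_norm_sq_pos hs hR
    refine (transportCost_le_of_integral_add_le (isCompact_closedBall 0 R) hν₁ hν₂ ?_
      (fun x hx y hy => barenblatt_log_nonneg hs (hpos x hx) (hpos y hy))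
      fun φ ψ => integral_add_integral_le_of_add_le_cost hs hR hν₁ hν₂ hν₂cent
        h₁.1 h₂.1 h₁.2 h₂.2 φ ψ).trans ENNReal.ofReal_add_le
    refine ContinuousOn.mul continuousOn_const (ContinuousOn.log ?_ fun p hp => ?_)
    · refine ContinuousOn.div (by fun_prop) (by fun_prop) fun p hp => ?_
      exact (mul_pos (Real.sqrt_pos.2 (hpos _ hp.1)) (Real.sqrt_pos.2 (hpos _ hp.2))).ne'
    · exact (div_pos (one_sub_mul_inner_pos hs (hpos _ hp.1) (hpos _ hp.2))
        (mul_pos (Real.sqrt_pos.2 (hpos _ hp.1)) (Real.sqrt_pos.2 (hpos _ hp.2)))).ne'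
  all_goals simp
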